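/- arXiv:1811.07210 — 5 statements merged into one kernel-verified Lean document; each statement's English description precedes it below -/
import Mathlib

section
/- (Fraïssé–Pouzet) An infinite structure Y in a relational first-order language L is monomorphic if and only if there exists a linear order < on the domain of Y that chains Y, i.e., Y is simply definable in a linear order. -/
open FirstOrder Cardinal

universe u v w w' x

/-- The substructure of an `L`-structure induced on a subset of its domain
(for a relational language every subset is the domain of an induced substructure). -/
def inducedStructure (L : FirstOrder.Language.{u, v}) [L.IsRelational] {M : Type w}
    [L.Structure M] (s : Set M) : L.Structure s where
  funMap f := isEmptyElim f
  RelMap R v := FirstOrder.Language.Structure.RelMap R (fun i => (v i : M))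

/-- A structure `M` is monomorphic if for every (positive) natural number `n`, any two
`n`-element subsets of its domain carry isomorphic induced substructures. -/
def IsMonomorphic (L : FirstOrder.Language.{u, v}) [L.IsRelational] (M : Type w)
    [L.Structure M] : Prop :=
  ∀ s t : Set M, s.Finite → t.Finite → s.ncard = t.ncard →
    Nonempty (@FirstOrder.Language.Equiv L s t (inducedStructure L s) (inducedStructure L t))

/-- A linear order on `A`, regarded as a structure for the language with a single binary
relation symbol, the symbol being interpreted as the strict order `<`. -/
def ltStructure {A : Type w} (lo : LinearOrder A) : FirstOrder.Language.order.Structure A where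
  funMap f := isEmptyElim f
  RelMap {n} r v := match n, r with
    | 2, .le => lo.lt (v 0) (v 1)

/-- A linear order on the domain of an `L`-structure `M` chains `M` (equivalently, `M` is
simply definable in the linear order) if every relation of `M` is defined by a
quantifier-free formula of the language of one binary relation symbol, realized in the
linear order. -/
def Chains (L : FirstOrder.Language.{u, v}) {M : Type w} [L.Structure M]
    (lo : LinearOrder M) : Prop :=
  ∀ (m : ℕ) (R : L.Relations m), ∃ φ : FirstOrder.Language.order.Formula (Fin m),
    φ.IsQF ∧ ∀ v : Fin m → M,
      FirstOrder.Language.Structure.RelMap R v ↔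
        @FirstOrder.Language.Formula.Realize _ _ (ltStructure lo) _ φ v

/-- The realization of a quantifier-free formula in a linear order depends only on the relative
order of the assigned elements. -/
theorem isQF_realize_congr {A B α : Type*} (lA : LinearOrder A) (lB : LinearOrder B) {n : ℕ}
    {φ : FirstOrder.Language.order.BoundedFormula α n} (hφ : φ.IsQF)
    (v : α → A) (xs : Fin n → A) (w : α → B) (ys : Fin n → B)
    (h : ∀ i j, Sum.elim v xs i < Sum.elim v xs j ↔ Sum.elim w ys i < Sum.elim w ys j) :
    @FirstOrder.Language.BoundedFormula.Realize _ _ (ltStructure lA) _ _ φ v xs ↔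
      @FirstOrder.Language.BoundedFormula.Realize _ _ (ltStructure lB) _ _ φ w ys := by
  let := ltStructure lA
  let := ltStructure lB
  induction hφ with
  | falsum => exact Iff.rfl
  | imp _ _ ih₁ ih₂ => exact imp_congr ih₁ ih₂
  | of_isAtomic hat =>
    cases hat with
    | equal t₁ t₂ =>
      cases t₁ with
      | func f _ => exact isEmptyElim f
      | var i =>
        cases t₂ with
        | func f _ => exact isEmptyElim f
        | var j =>
          simp only [FirstOrder.Language.BoundedFormula.realize_bdEqual,
            FirstOrder.Language.Term.realize_var]
          rw [eq_iff_le_not_lt, eq_iff_le_not_lt, ← not_lt, ← not_lt, h, h]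
    | @rel l R ts =>
      match l, R, ts with
      | 2, .le, ts =>
        change (ts 0).realize _ < (ts 1).realize _ ↔ (ts 0).realize _ < (ts 1).realize _
        cases ts 0 with
        | func f _ => exact isEmptyElim f
        | var i =>
          cases ts 1 with
          | func f _ => exact isEmptyElim f
          | var j => exact h i j

theorem isQF_iSup {L' : FirstOrder.Language} {α β : Type*} {n : ℕ} [Finite β]
    {f : β → L'.BoundedFormula α n} (h : ∀ b, (f b).IsQF) :
    (FirstOrder.Language.BoundedFormula.iSup f).IsQF := by
  change (((@Finset.univ β (Fintype.ofFinite β)).toList.map f).foldr (· ⊔ ·) ⊥).IsQF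
  induction (@Finset.univ β (Fintype.ofFinite β)).toList with
  | nil => exact FirstOrder.Language.BoundedFormula.isQF_bot
  | cons b l ih => exact (h b).sup ih

theorem isQF_iInf {L' : FirstOrder.Language} {α β : Type*} {n : ℕ} [Finite β]
    {f : β → L'.BoundedFormula α n} (h : ∀ b, (f b).IsQF) :
    (FirstOrder.Language.BoundedFormula.iInf f).IsQF := by
  change (((@Finset.univ β (Fintype.ofFinite β)).toList.map f).foldr (· ⊓ ·) ⊤).IsQF
  induction (@Finset.univ β (Fintype.ofFinite β)).toList with
  | nil => exact FirstOrder.Language.BoundedFormula.IsQF.top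
  | cons b l ih => exact (h b).inf ih

/-- Every prescribed pattern of strict inequalities between the coordinates of an `m`-tuple is
expressed by a quantifier-free formula. -/
theorem exists_isQF_realize_iff_pattern (m : ℕ) (r : Fin m → Fin m → Prop) :
    ∃ φ : FirstOrder.Language.order.Formula (Fin m), φ.IsQF ∧
      ∀ {A : Type w} (lo : LinearOrder A) (v : Fin m → A),
        @FirstOrder.Language.Formula.Realize _ _ (ltStructure lo) _ φ v ↔
          ∀ i j, v i < v j ↔ r i j := by
  classical
  let atom (i j : Fin m) : FirstOrder.Language.order.Formula (Fin m) :=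
    FirstOrder.Language.Relations.formula₂ FirstOrder.Language.orderRel.le
      (FirstOrder.Language.Term.var i) (FirstOrder.Language.Term.var j)
  have hatom : ∀ i j, (atom i j).IsQF := fun i j =>
    (FirstOrder.Language.BoundedFormula.IsAtomic.rel _ _).isQF
  refine ⟨FirstOrder.Language.Formula.iInf
    fun p : Fin m × Fin m => if r p.1 p.2 then atom p.1 p.2 else (atom p.1 p.2).not,
    isQF_iInf fun p => ?_, fun {A} lo v => ?_⟩
  · split_ifs
    · exact hatom _ _
    · exact (hatom _ _).not
  · let := ltStructure lo
    have hreal : ∀ i j, (atom i j).Realize v ↔ v i < v j := fun _ _ => Iff.rfl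
    rw [FirstOrder.Language.Formula.realize_iInf, Prod.forall]
    refine forall₂_congr fun i j => ?_
    split_ifs with hr
    · simp [hr, hreal]
    · simp only [hr, iff_false, FirstOrder.Language.Formula.realize_not, hreal]

/-- A linear order chains a structure iff membership in each relation depends only on the relative
order of the coordinates. -/
theorem chains_iff (L : FirstOrder.Language.{u, v}) {M : Type w} [L.Structure M]
    (lo : LinearOrder M) :
    Chains L lo ↔ ∀ (m : ℕ) (R : L.Relations m) (v w : Fin m → M),
      (∀ i j, v i < v j ↔ w i < w j) →
        (FirstOrder.Language.Structure.RelMap R v ↔ FirstOrder.Language.Structure.RelMap R w) := by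
  constructor
  · intro h m R v w hvw
    obtain ⟨φ, hφ, hR⟩ := h m R
    rw [hR, hR]
    refine isQF_realize_congr lo lo hφ _ _ _ _ ?_
    rintro (i | i) (j | j)
    · exact hvw i j
    all_goals first | exact i.elim0 | exact j.elim0
  · intro h m R
    choose φ hφ hreal using exists_isQF_realize_iff_pattern.{w} m
    let T := {r : Fin m → Fin m → Prop //
      ∃ v : Fin m → M, (∀ i j, v i < v j ↔ r i j) ∧ FirstOrder.Language.Structure.RelMap R v}
    refine ⟨FirstOrder.Language.Formula.iSup fun r : T => φ r.1, isQF_iSup fun r => hφ r.1,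
      fun v => ?_⟩
    let := ltStructure lo
    rw [FirstOrder.Language.Formula.realize_iSup]
    constructor
    · intro hv
      exact ⟨⟨fun i j => v i < v j, v, fun _ _ => Iff.rfl, hv⟩,
        (hreal _ lo v).2 fun _ _ => Iff.rfl⟩
    · rintro ⟨⟨r, w, hw, hRw⟩, hv⟩
      have hv' := (hreal r lo v).1 hv
      exact (h m R v w fun i j => (hv' i j).trans (hw i j).symm).2 hRw

/-- The limit value, along an ultrafilter, of a predicate on lists after appending `k` generic
elements. -/
def ultraLimit {M : Type*} (U : Ultrafilter M) (c : List M → Prop) : ℕ → List M → Prop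
  | 0, l => c l
  | k + 1, l => ∀ᶠ x in (U : Filter M), ultraLimit U c k (l ++ [x])

/-- The infinite Ramsey theorem in the following finitary form: finitely many predicates on lists in
an infinite type admit arbitrarily long lists on whose sublists they depend only on the length. -/
theorem exists_nodup_homogeneous {M : Type*} [Infinite M] {I : Type*} [Finite I]
    (c : I → List M → Prop) (N : ℕ) :
    ∃ A : List M, A.Nodup ∧ A.length = N ∧ ∀ l l' : List M, l.Sublist A → l'.Sublist A →
      l.length = l'.length → ∀ i, c i l ↔ c i l' := by
  let U := Filter.hyperfilter M
  have key : ∀ N K : ℕ, ∃ A : List M, A.Nodup ∧ A.length = N ∧ ∀ l : List M, l.Sublist A →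
      ∀ k ≤ K, ∀ i, ultraLimit U (c i) k l ↔ ultraLimit U (c i) (k + l.length) [] := by
    intro N
    induction N with
    | zero =>
      intro K
      refine ⟨[], List.nodup_nil, rfl, fun l hl k _ i => ?_⟩
      rw [List.sublist_nil.1 hl]
      rfl
    | succ N ih =>
      intro K
      obtain ⟨A, hA, hN, hgood⟩ := ih (K + 1)
      have hnew : ∀ᶠ x in (U : Filter M), x ∉ A := by
        have : {x | x ∈ A}.Finite := A.finite_toSet
        exact this.compl_mem_hyperfilter
      have hlim : ∀ᶠ x in (U : Filter M), ∀ l ∈ {l : List M | l.Sublist A},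
          ∀ k ∈ Set.Iic K, ∀ i, ultraLimit U (c i) k (l ++ [x]) ↔ ultraLimit U (c i) (k + 1) l := by
        have hfin : {l : List M | l.Sublist A}.Finite :=
          (List.finite_toSet A.sublists).subset fun l hl => List.mem_sublists.2 hl
        rw [Filter.eventually_all_finite hfin]
        intro l _
        rw [Filter.eventually_all_finite (Set.finite_Iic K)]
        intro k _
        rw [Filter.eventually_all]
        intro i
        by_cases h : ultraLimit U (c i) (k + 1) l
        · exact h.mono fun x hx => iff_of_true hx h
        · exact (Ultrafilter.eventually_not.2 h).mono fun x hx => iff_of_false hx h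
      obtain ⟨x, hx, hx'⟩ := (hnew.and hlim).exists
      refine ⟨A ++ [x], ?_, by simp [hN], fun l hl k hk i => ?_⟩
      · rw [List.nodup_append]
        refine ⟨hA, List.nodup_singleton x, ?_⟩
        rintro a ha b hb rfl
        exact hx (List.mem_singleton.1 hb ▸ ha)
      · obtain ⟨l₁, l₂, rfl, h₁, h₂⟩ := List.sublist_append_iff.1 hl
        rcases List.sublist_singleton.1 h₂ with rfl | rfl
        · simpa using hgood l₁ h₁ k (by omega) i
        · rw [hx' l₁ h₁ k hk i, hgood l₁ h₁ (k + 1) (by omega) i]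
          rw [List.length_append, List.length_singleton, Nat.add_assoc, Nat.add_comm 1]
  obtain ⟨A, hA, hN, hgood⟩ := key N 0
  refine ⟨A, hA, hN, fun l l' hl hl' hlen i => ?_⟩
  have h₁ := hgood l hl 0 le_rfl i
  have h₂ := hgood l' hl' 0 le_rfl i
  rw [hlen] at h₁
  exact h₁.trans h₂.symm

/-- For finitely many relations on an infinite structure there are order-indiscernible sequences of
any finite length. -/
theorem exists_indiscernible (L : FirstOrder.Language.{u, v}) {M : Type w} [L.Structure M]
    [Infinite M] (S : Finset (Σ m, L.Relations m)) (N : ℕ) :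
    ∃ f : Fin N → M, Function.Injective f ∧ ∀ s ∈ S, ∀ p q : Fin s.1 → Fin N,
      (∀ i j, p i < p j ↔ q i < q j) →
        (FirstOrder.Language.Structure.RelMap s.2 (f ∘ p) ↔
          FirstOrder.Language.Structure.RelMap s.2 (f ∘ q)) := by
  let c (a : Σ s : S, Fin s.1.1 → Fin N) (l : List M) : Prop :=
    ∃ h : ∀ i, (a.2 i : ℕ) < l.length,
      FirstOrder.Language.Structure.RelMap a.1.1.2 fun i => l[(a.2 i : ℕ)]'(h i)
  obtain ⟨A, hA, rfl, hhom⟩ := exists_nodup_homogeneous c N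
  refine ⟨A.get, List.nodup_iff_injective_get.1 hA, fun s hs p q hpq => ?_⟩
  have heq : ∀ i j, p i = p j → q i = q j := fun i j hij => by
    have h₁ := hpq i j
    have h₂ := hpq j i
    rw [hij] at h₁ h₂
    simp only [lt_self_iff_false, false_iff, not_lt] at h₁ h₂
    exact le_antisymm h₂ h₁
  let e := Function.extend p q id
  have he : ∀ i, e (p i) = q i := fun i =>
    Function.FactorsThrough.extend_apply (fun i j h => heq i j h) id i
  let l := (Finset.univ.image p).sort
  have hmem : ∀ x ∈ l, ∃ i, p i = x := fun x hx => by simpa [l] using hx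
  have hl : l.Pairwise (· < ·) := (Finset.sortedLT_sort _).pairwise
  have hl' : (l.map e).Pairwise (· < ·) := by
    rw [List.pairwise_map]
    refine hl.imp_of_mem fun {a b} ha hb hab => ?_
    obtain ⟨i, rfl⟩ := hmem a ha
    obtain ⟨j, rfl⟩ := hmem b hb
    rw [he, he]
    exact (hpq i j).1 hab
  have hsub : ∀ l : List (Fin A.length), l.Pairwise (· < ·) → (l.map A.get).Sublist A := by
    intro l hl
    have : l.Sublist (List.finRange A.length) :=
      List.sublist_of_subperm_of_sortedLE
        (List.Nodup.subperm hl.sortedLT.nodup fun x _ => List.mem_finRange x)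
        hl.sortedLT.sortedLE (List.sortedLT_finRange _).sortedLE
    simpa using this.map A.get
  have hlen : l.length ≤ A.length := by simpa using (hsub l hl).length_le
  have hσ : ∀ i, ∃ k : Fin A.length, ∃ h : (k : ℕ) < l.length, l[(k : ℕ)] = p i := fun i => by
    obtain ⟨k, hk, h⟩ := List.getElem_of_mem (show p i ∈ l by simp [l])
    exact ⟨⟨k, hk.trans_le hlen⟩, hk, h⟩
  choose σ hσl hσ using hσ
  have hc := hhom _ _ (hsub l hl) (hsub _ hl') (by simp) ⟨⟨s, hs⟩, σ⟩
  have h₁ : c ⟨⟨s, hs⟩, σ⟩ (l.map A.get) ↔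
      FirstOrder.Language.Structure.RelMap s.2 (A.get ∘ p) := by
    simp only [c, List.length_map, hσl, implies_true, List.getElem_map, hσ, exists_true_left]
    exact Iff.rfl
  have h₂ : c ⟨⟨s, hs⟩, σ⟩ ((l.map e).map A.get) ↔
      FirstOrder.Language.Structure.RelMap s.2 (A.get ∘ q) := by
    simp only [c, List.length_map, hσl, implies_true, List.getElem_map, hσ, he, exists_true_left]
    exact Iff.rfl
  exact h₁.symm.trans (hc.trans h₂)

/-- In an infinite monomorphic structure, every finite subset can be ranked so that finitely many
given relations depend, on this subset, only on the relative rank of the coordinates. -/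
theorem IsMonomorphic.exists_rank {L : FirstOrder.Language.{u, v}} [L.IsRelational] {M : Type w}
    [L.Structure M] [Infinite M] (h : IsMonomorphic L M) (S : Finset (Σ m, L.Relations m))
    (F : Finset M) :
    ∃ g : M → ℕ, Set.InjOn g F ∧ ∀ s ∈ S, ∀ v w : Fin s.1 → M,
      (∀ i, v i ∈ F) → (∀ i, w i ∈ F) → (∀ i j, g (v i) < g (v j) ↔ g (w i) < g (w j)) →
        (FirstOrder.Language.Structure.RelMap s.2 v ↔
          FirstOrder.Language.Structure.RelMap s.2 w) := by
  classical
  obtain ⟨f, hf, hind⟩ := exists_indiscernible L (M := M) S F.card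
  have hcard : (F : Set M).ncard = (Set.range f).ncard := by
    rw [Set.ncard_coe_finset, ← Set.image_univ, Set.ncard_image_of_injective _ hf]
    simp
  let := inducedStructure L (F : Set M)
  let := inducedStructure L (Set.range f)
  obtain ⟨e⟩ := h F (Set.range f) F.finite_toSet (Set.finite_range f) hcard
  have hrank : ∀ x : (F : Set M), ∃ k, f k = (e.toEquiv x : M) := fun x => (e.toEquiv x).2
  choose r hr using hrank
  have hrinj : Function.Injective r := fun x y hxy =>
    e.toEquiv.injective (Subtype.ext (by rw [← hr, ← hr, hxy]))
  have hrel : ∀ {m : ℕ} (R : L.Relations m) (v : Fin m → (F : Set M)),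
      FirstOrder.Language.Structure.RelMap R (fun i => (v i : M)) ↔
        FirstOrder.Language.Structure.RelMap R (f ∘ r ∘ v) := fun R v => by
    have hmap := e.map_rel' R v
    have hcomp : f ∘ r ∘ v = fun i => (e.toEquiv (v i) : M) := funext fun i => hr (v i)
    rw [hcomp]
    exact hmap.symm
  refine ⟨fun x => if hx : x ∈ (F : Set M) then r ⟨x, hx⟩ else 0, ?_, ?_⟩
  · intro x hx y hy hxy
    simp only [hx, hy, dif_pos] at hxy
    exact congrArg Subtype.val (hrinj (Fin.ext hxy))
  · intro s hs v w hv hw hvw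
    have hv' : ∀ i, v i ∈ (F : Set M) := hv
    have hw' : ∀ i, w i ∈ (F : Set M) := hw
    simp only [hv', hw', dif_pos, Fin.val_fin_lt] at hvw
    exact (hrel s.2 fun i => ⟨v i, hv' i⟩).trans
      ((hind s hs _ _ hvw).trans (hrel s.2 fun i => ⟨w i, hw' i⟩).symm)

theorem IsMonomorphic.exists_chains {L : FirstOrder.Language.{u, v}} [L.IsRelational] {M : Type w}
    [L.Structure M] [Infinite M] (h : IsMonomorphic L M) :
    ∃ lo : LinearOrder M, Chains L lo := by
  classical
  choose g hinj hg using h.exists_rank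
  let J := Finset (Σ m, L.Relations m) × Finset M
  let U : Ultrafilter J := Ultrafilter.of Filter.atTop
  have hU : ∀ j : J, ∀ᶠ i in (U : Filter J), j ≤ i := fun j =>
    Ultrafilter.of_le _ (Filter.eventually_ge_atTop j)
  let G (x : M) : Filter.Germ (U : Filter J) ℕ := ((fun j : J => g j.1 j.2 x : J → ℕ) :)
  have hG : Function.Injective G := fun x y hxy => by
    obtain ⟨j, hj, hj'⟩ := ((Filter.Germ.coe_eq.1 hxy).and (hU (∅, {x, y}))).exists
    exact hinj j.1 j.2 (hj'.2 (by simp)) (hj'.2 (by simp)) hj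
  refine ⟨LinearOrder.lift' G hG, (chains_iff L _).2 fun m R v w hvw => ?_⟩
  have hlt : ∀ᶠ j in (U : Filter J), ∀ a b,
      (g j.1 j.2 (v a) < g j.1 j.2 (v b) ↔ g j.1 j.2 (w a) < g j.1 j.2 (w b)) := by
    simp only [Filter.eventually_all]
    intro a b
    have hab : G (v a) < G (v b) ↔ G (w a) < G (w b) := hvw a b
    by_cases hv : G (v a) < G (v b)
    · filter_upwards [Filter.Germ.coe_lt.1 hv, Filter.Germ.coe_lt.1 (hab.1 hv)] with j h₁ h₂
      exact iff_of_true h₁ h₂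
    · have hw := mt hab.2 hv
      rw [Filter.Germ.coe_lt, ← Ultrafilter.eventually_not] at hv hw
      filter_upwards [hv, hw] with j h₁ h₂
      exact iff_of_false h₁ h₂
  obtain ⟨j, hj, hj'⟩ :=
    (hlt.and (hU ({⟨m, R⟩}, Finset.univ.image v ∪ Finset.univ.image w))).exists
  exact hg j.1 j.2 ⟨m, R⟩ (hj'.1 (by simp)) v w (fun i => hj'.2 (by simp))
    (fun i => hj'.2 (by simp)) hj

theorem Chains.isMonomorphic {L : FirstOrder.Language.{u, v}} [L.IsRelational] {M : Type w}
    [L.Structure M] {lo : LinearOrder M} (h : Chains L lo) : IsMonomorphic L M := by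
  intro s t hs ht hst
  have := hs.fintype
  have := ht.fintype
  have hcard : Fintype.card s = Fintype.card t := by
    rwa [← Nat.card_eq_fintype_card, ← Nat.card_eq_fintype_card, Nat.card_coe_set_eq,
      Nat.card_coe_set_eq]
  let e : s ≃o t := (Fintype.orderIsoFinOfCardEq s hcard).symm.trans
    (Fintype.orderIsoFinOfCardEq t rfl)
  let := inducedStructure L s
  let := inducedStructure L t
  refine ⟨⟨e.toEquiv, fun f => isEmptyElim f, fun {m} R v => ?_⟩⟩
  exact (chains_iff L lo).1 h m R _ _ fun i j => e.lt_iff_lt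

/-- **Fraïssé–Pouzet theorem.** An infinite structure in a relational language is
monomorphic iff it is simply definable in a linear order, i.e., iff some linear order on
its domain chains it. -/
theorem monomorphic_iff_simply_definable_in_linear_order
    (L : FirstOrder.Language.{u, v}) [L.IsRelational] (M : Type w) [L.Structure M]
    [Infinite M] :
    IsMonomorphic L M ↔ ∃ lo : LinearOrder M, Chains L lo := by
  exact ⟨fun h => h.exists_chains, fun ⟨_, h⟩ => h.isMonomorphic⟩
end

section
/- (Gibson–Pouzet–Woodrow) Let Y be an infinite monomorphic structure in a relational language L and let < be a linear order on the domain Y chaining Y; write X = (Y,<). Then at least one of the following holds: (i) every linear order on the domain Y chains Y; (ii) the linear orders on Y chaining Y are exactly the orders of the form F+I and their reverses, where Y is partitioned into an initial segment I of X and the complementary final segment F, and F+I denotes the linear order on Y in which every element of F precedes every element of I and elements within F and within I are compared by <; (iii) there are finite subsets K and H of Y such that K is an initial segment of X, H is a final segment of X, and with M = Y \ (K ∪ H), the linear orders on Y chaining Y are exactly the orders of the form ⊲_K + (M,<) + ⊲_H and their reverses, where ⊲_K ranges over all linear orders on K, ⊲_H ranges over all linear orders on H, and + denotes concatenation (every element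 of an earlier block precedes every element of a later block). -/
open FirstOrder Cardinal

universe u v w w' x

/-- Given a linear order `lo` on `M` and a subset `I ⊆ M` (thought of as an initial segment,
with complementary final segment `F = Iᶜ`), `cutRel lo I` is the strict linear order `F + I`:
first the elements of `F` (in the order `lo`), then the elements of `I` (in the order `lo`). -/
def cutRel {M : Type w} (lo : LinearOrder M) (I : Set M) : M → M → Prop := fun a b =>
  (a ∉ I ∧ b ∉ I ∧ lo.lt a b) ∨ (a ∈ I ∧ b ∈ I ∧ lo.lt a b) ∨ (a ∉ I ∧ b ∈ I)

/-- Given a linear order `lo` on `M`, disjoint subsets `K` and `H` of `M`, a strict linear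
order `ltK` on `K` and a strict linear order `ltH` on `H`, `tripleRel lo K H ltK ltH` is the
concatenated strict linear order `(K, ltK) + (M \ (K ∪ H), lo) + (H, ltH)`. -/
def tripleRel {M : Type w} (lo : LinearOrder M) (K H : Set M)
    (ltK : K → K → Prop) (ltH : H → H → Prop) : M → M → Prop := fun a b =>
  (∃ (ha : a ∈ K) (hb : b ∈ K), ltK ⟨a, ha⟩ ⟨b, hb⟩) ∨
  (a ∈ K ∧ b ∉ K) ∨
  (a ∉ K ∧ a ∉ H ∧ b ∉ K ∧ b ∉ H ∧ lo.lt a b) ∨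
  (a ∉ K ∧ a ∉ H ∧ b ∈ H) ∨
  (∃ (ha : a ∈ H) (hb : b ∈ H), ltH ⟨a, ha⟩ ⟨b, hb⟩)

namespace GibsonPouzetWoodrow

open Function Filter

section Lists

variable {M : Type w}

theorem exists_fresh_list [Infinite M] (l : List M) (n : ℕ) :
    ∃ B : List M, B.length = n ∧ B.Nodup ∧ ∀ x ∈ B, x ∉ l := by
  classical
  have h : ({x | x ∈ l}ᶜ : Set M).Infinite :=
    (List.finite_toSet l).infinite_compl
  obtain ⟨t, ht, hn⟩ := h.exists_subset_card_eq n
  refine ⟨t.toList, by simpa using hn, t.nodup_toList, fun x hx => ht (by simpa using hx)⟩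

theorem exists_fresh_append [Infinite M] {l : List M} (hl : l.Nodup) (n : ℕ) :
    ∃ B : List M, B.length = n ∧ (l ++ B).Nodup := by
  obtain ⟨B, hn, hB, h⟩ := exists_fresh_list l n
  exact ⟨B, hn, List.nodup_append.2 ⟨hl, hB, fun a ha b hb hab => h b hb (hab ▸ ha)⟩⟩

/-- Duplicate-free lists of the same length are relabellings of each other. -/
theorem exists_relabel {l l₀ : List M} (hl : l.Nodup) (hl₀ : l₀.Nodup)
    (hlen : l.length = l₀.length) : ∃ f : M → M, l.map f = l₀ ∧ Set.InjOn f {x | x ∈ l} := by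
  classical
  have key : ∃ f : M → M, l.map f = l₀ := by
    refine ⟨fun x => (l₀[l.idxOf x]?).getD x, ?_⟩
    apply List.ext_getElem (by simpa using hlen)
    intro i h1 h2
    simp [hl.idxOf_getElem, h2]
  obtain ⟨f, hf⟩ := key
  refine ⟨f, hf, ?_⟩
  exact (List.nodup_map_iff_inj_on hl).1 (hf ▸ hl₀)

variable (r : M → M → Prop) [IsStrictTotalOrder M r]

theorem exists_sorted_perm {l : List M} (hl : l.Nodup) :
    ∃ l' : List M, l.Perm l' ∧ l'.Pairwise r := by
  classical
  induction l with
  | nil => exact ⟨[], .refl _, .nil⟩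
  | cons x l ih =>
    obtain ⟨l', hp, hs⟩ := ih hl.of_cons
    have hx : ∀ y ∈ l', y ≠ x := fun y hy e =>
      (List.nodup_cons.1 hl).1 (hp.mem_iff.2 (e ▸ hy))
    refine ⟨l'.filter (fun y => r y x) ++ x :: l'.filter (fun y => ¬ r y x), ?_, ?_⟩
    · refine List.Perm.trans ?_ List.perm_middle.symm
      refine List.Perm.cons _ (hp.trans ?_)
      simpa using (List.filter_append_perm (fun y => decide (r y x)) l').symm
    · have hgt : ∀ y ∈ l', ¬ r y x → r x y := fun y hy h =>
        ((trichotomous_of r x y).resolve_right (by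
          rintro (e | e)
          · exact hx y hy e.symm
          · exact h e))
      rw [List.pairwise_append]
      refine ⟨hs.filter _, List.pairwise_cons.2 ⟨?_, hs.filter _⟩, ?_⟩
      · simpa using hgt
      · intro a ha b hb
        simp only [List.mem_filter, decide_eq_true_eq] at ha
        simp only [List.mem_cons, List.mem_filter, decide_eq_true_eq] at hb
        rcases hb with rfl | hb
        · exact ha.2
        · exact _root_.trans ha.2 (hgt b hb.1 hb.2)

variable {r}

theorem nodup_of_pairwise {l : List M} (h : l.Pairwise r) : l.Nodup :=
  h.imp fun {a b} (hab : r a b) (e : a = b) => irrefl_of r a (by rwa [← e] at hab)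

theorem eq_of_perm_of_pairwise {l l' : List M} (h : l.Perm l') (hl : l.Pairwise r)
    (hl' : l'.Pairwise r) : l = l' :=
  List.Perm.eq_of_pairwise (fun _ _ _ _ h h' => (asymm_of r h h').elim) hl hl' h

end Lists

section PatternEquiv

variable {M : Type w}

/-- A relation between duplicate-free lists that are permutations of each other, invariant under
deleting labels and under renaming labels. -/
structure IsPatternEquiv (E : List M → List M → Prop) : Prop where
  nodup : ∀ {l l'}, E l l' → l.Nodup
  perm : ∀ {l l'}, E l l' → l.Perm l'
  refl : ∀ {l}, l.Nodup → E l l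
  symm : ∀ {l l'}, E l l' → E l' l
  trans : ∀ {l l' l''}, E l l' → E l' l'' → E l l''
  filter : ∀ {l l'} (p : M → Bool), E l l' → E (l.filter p) (l'.filter p)
  map : ∀ {l l'} (f : M → M), Set.InjOn f {x | x ∈ l} → E l l' → E (l.map f) (l'.map f)

/-- The conjugate of a relation between lists by list reversal. -/
def revRel (E : List M → List M → Prop) : List M → List M → Prop :=
  fun l l' => E l.reverse l'.reverse

theorem revRel_revRel (E : List M → List M → Prop) : revRel (revRel E) = E := by
  funext l l'
  simp [revRel]

theorem IsPatternEquiv.rev {E : List M → List M → Prop} (hE : IsPatternEquiv E) :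
    IsPatternEquiv (revRel E) where
  nodup h := by simpa using hE.nodup h
  perm {l l'} h := (l.reverse_perm.symm.trans (hE.perm h)).trans l'.reverse_perm
  refl h := hE.refl (by simpa using h)
  symm h := hE.symm h
  trans h h' := hE.trans h h'
  filter p h := by simpa [revRel] using hE.filter p h
  map f hf h := by simpa [revRel] using hE.map f (by simpa using hf) h

/-- All duplicate-free permutations are related. -/
def IsFull (E : List M → List M → Prop) : Prop :=
  ∀ l l' : List M, l.Nodup → l.Perm l' → E l l'

/-- Every list is related to its rotations. -/
def IsCyclic (E : List M → List M → Prop) : Prop :=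
  ∀ (x : M) (B : List M), (x :: B).Nodup → E (x :: B) (B ++ [x])

/-- The entries at positions `i` and `i + 1` can be exchanged in every list. -/
def SwapAt (E : List M → List M → Prop) (i : ℕ) : Prop :=
  ∀ (u : List M) (x y : M) (B : List M), u.length = i → (u ++ x :: y :: B).Nodup →
    E (u ++ x :: y :: B) (u ++ y :: x :: B)

/-- Two lists stay related after appending any common tail. -/
def TailEquiv (E : List M → List M → Prop) (l l' : List M) : Prop :=
  ∀ B : List M, (l ++ B).Nodup → E (l ++ B) (l' ++ B)

variable {E : List M → List M → Prop}

theorem IsFull.of_rev (h : IsFull (revRel E)) : IsFull E := fun l l' hl hp => by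
  simpa [revRel] using h l.reverse l'.reverse (by simpa using hl)
    ((l.reverse_perm.trans hp).trans l'.reverse_perm.symm)

namespace IsPatternEquiv

theorem isCyclic_rev (hE : IsPatternEquiv E)
    (h : IsCyclic E) : IsCyclic (revRel E) := fun x B hB => by
  have := h x B.reverse (by simpa using hB)
  simpa [revRel] using hE.symm this

theorem cyclic_append (hE : IsPatternEquiv E)
    (h : IsCyclic E) (i f : List M) (hn : (i ++ f).Nodup) :
    E (i ++ f) (f ++ i) := by
  induction i generalizing f with
  | nil => simpa using hE.refl (by simpa using hn)
  | cons x i ih =>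
    have h1 := h x (i ++ f) (by simpa using hn)
    have h2 := ih (f ++ [x]) (by
      have := (hE.perm h1).nodup_iff.1 (by simpa using hn)
      simpa using this)
    simpa using hE.trans h1 (by simpa using h2)

theorem of_swapAt (hE : IsPatternEquiv E)
    {n : ℕ} (h : ∀ i, i + 1 < n → SwapAt E i) {l l' : List M} (hp : l.Perm l')
    (u B : List M) (hu : u.length + l.length ≤ n) (hn : (u ++ l ++ B).Nodup) :
    E (u ++ l ++ B) (u ++ l' ++ B) := by
  induction hp generalizing u with
  | nil => exact hE.refl hn
  | cons x _ ih =>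
    simpa using ih (u ++ [x]) (by simp at hu ⊢; omega) (by simpa using hn)
  | swap x y l =>
    simpa using h u.length (by simp at hu; omega) u y x (l ++ B) rfl (by simpa using hn)
  | trans h₁ h₂ ih₁ ih₂ =>
    have h3 := ih₁ u hu hn
    exact hE.trans h3 (ih₂ u (by rwa [← h₁.length_eq]) ((hE.perm h3).nodup_iff.1 hn))

theorem isFull_of_swapAt (hE : IsPatternEquiv E)
    (h : ∀ i, SwapAt E i) : IsFull E := fun l l' hl hp => by
  simpa using hE.of_swapAt (n := l.length) (fun i _ => h i) hp [] [] (by simp) (by simpa using hl)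

theorem swapAt_of_eq (hE : IsPatternEquiv E) {u u₀ B B₀ : List M} {x y x₀ y₀ : M}
    (h : E (u ++ x :: y :: B) (u ++ y :: x :: B)) (hu : u.length = u₀.length)
    (hB : B.length = B₀.length) (hn : (u₀ ++ x₀ :: y₀ :: B₀).Nodup) :
    E (u₀ ++ x₀ :: y₀ :: B₀) (u₀ ++ y₀ :: x₀ :: B₀) := by
  obtain ⟨f, hf, hinj⟩ := exists_relabel (hE.nodup h) hn (by simp [hu, hB])
  have h' := hE.map f hinj h
  rw [hf] at h'
  rw [List.map_append] at hf
  obtain ⟨h1, h2⟩ := List.append_inj hf (by simpa using hu)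
  simp only [List.map_cons, List.cons.injEq] at h2
  simpa [h1, h2.1, h2.2.1, h2.2.2] using h'

theorem filter_ne (hE : IsPatternEquiv E) [DecidableEq M] (z : M) {l l' : List M} (h : E l l') :
    E (l.filter (· ≠ z)) (l'.filter (· ≠ z)) := hE.filter _ h

/-- Deleting `z` from two lists that stay related under common tails, and reinserting it at the
start of the tail. -/
theorem tailEquiv_erase (hE : IsPatternEquiv E) [Infinite M] {a b a' b' : List M} {z : M}
    (h : TailEquiv E (a ++ z :: b) (a' ++ z :: b')) :
    ∀ B, (a ++ z :: b ++ B).Nodup → E (a ++ b ++ z :: B) (a' ++ b' ++ z :: B) := by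
  classical
  intro B hB
  obtain ⟨c, hc⟩ := Set.Infinite.nonempty (List.finite_toSet (a ++ z :: b ++ B)).infinite_compl
  have hc : c ∉ a ++ z :: b ++ B := hc
  have hn : (a ++ z :: b ++ c :: B).Nodup :=
    List.perm_middle.nodup_iff.2 (List.nodup_cons.2 ⟨hc, hB⟩)
  have h1 := h (c :: B) hn
  have hn' := (hE.perm h1).nodup_iff.1 hn
  have h2 := hE.map (Equiv.swap c z) (Equiv.injective _).injOn (hE.filter_ne z h1)
  have hs : ∀ l : List M, z ∉ l → c ∉ l → (l.filter (· ≠ z)).map (Equiv.swap c z) = l := by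
    intro l hz hc
    rw [List.filter_eq_self.2 fun a ha => by
      simp only [ne_eq, decide_not, Bool.not_eq_true', decide_eq_false_iff_not]
      exact fun e => hz (e ▸ ha)]
    conv_rhs => rw [← List.map_id l]
    refine List.map_congr_left fun x hx => Equiv.swap_apply_of_ne_of_ne ?_ ?_
    · exact fun e => hc (e ▸ hx)
    · exact fun e => hz (e ▸ hx)
  have key : ∀ p q : List M, (p ++ z :: q ++ c :: B).Nodup →
      ((p ++ z :: q ++ c :: B).filter (· ≠ z)).map (Equiv.swap c z) = p ++ q ++ z :: B := by
    intro p q hpq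
    have hz : z ∉ p ∧ z ∉ q ∧ z ≠ c ∧ z ∉ B := by
      have : (z :: (p ++ q ++ c :: B)).Nodup := by
        refine List.Perm.nodup ?_ hpq
        simp
      have := (List.nodup_cons.1 this).1
      simpa [not_or, and_assoc] using this
    have hc : c ∉ p ∧ c ∉ q ∧ c ∉ B := by
      have := (List.nodup_cons.1 (List.perm_middle.nodup hpq)).1
      simp only [List.mem_append, List.mem_cons, not_or] at this
      tauto
    simp only [List.filter_append, List.map_append]
    rw [hs p hz.1 hc.1, List.filter_cons_of_neg (by simp), hs q hz.2.1 hc.2.1,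
      List.filter_cons_of_pos (by simpa using hz.2.2.1.symm), List.map_cons,
      hs B hz.2.2.2 hc.2.2, Equiv.swap_apply_left]
  rw [key a b hn, key a' b' hn'] at h2
  exact h2

theorem swapAt_of_tailEquiv (hE : IsPatternEquiv E) [Infinite M] {u v w : List M} {y z : M} {i : ℕ}
    (h : TailEquiv E (u ++ [z]) (v ++ z :: (w ++ [y]))) (hn : (u ++ [z]).Nodup)
    (hu : u.length = i + 1) : SwapAt E i := by
  have h1 : TailEquiv E (v ++ z :: (w ++ [y])) (v ++ w ++ y :: [z]) := fun B hB => by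
    have hB' : (u ++ [z] ++ B).Nodup := by
      have hp := hE.perm (h [] (by simpa using hn))
      simp only [List.append_nil] at hp
      exact (hp.append_right B).nodup_iff.2 hB
    have h2 := hE.tailEquiv_erase (a := u) (b := []) h B hB'
    have h3 := hE.symm (h B hB')
    refine hE.trans h3 ?_
    simpa using h2
  have h4 : TailEquiv E (v ++ w ++ y :: [z]) (v ++ w ++ z :: [y]) := fun B hB => by
    have h1' : TailEquiv E ((v ++ z :: w) ++ y :: []) (v ++ w ++ y :: [z]) := by simpa using h1
    have hB' : ((v ++ z :: w) ++ y :: [] ++ B).Nodup := by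
      have hp := hE.perm (h [] (by simpa using hn))
      simp only [List.append_nil] at hp
      have hp' := hE.perm (h1 [] (by simpa using hp.nodup_iff.1 hn))
      simp only [List.append_nil] at hp'
      simpa using (hp'.append_right B).nodup_iff.2 hB
    have h5 := hE.tailEquiv_erase h1' B hB'
    have h6 := h1' B hB'
    have := hE.trans (hE.symm h6) (by simpa using h5)
    simpa using this
  have hp := hE.perm (h [] (by simpa using hn))
  simp only [List.append_nil] at hp
  have hn1 := hp.nodup_iff.1 hn
  have hp' := hE.perm (h1 [] (by simpa using hn1))
  simp only [List.append_nil] at hp'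
  have hn2 := hp'.nodup_iff.1 hn1
  intro u₀ x₀ y₀ B₀ hu₀ hn₀
  obtain ⟨B, hB, hBn⟩ := exists_fresh_append hn2 B₀.length
  have h7 := h4 B hBn
  refine hE.swapAt_of_eq (u := v ++ w) (x := y) (y := z) (B := B) (by simpa using h7) ?_ hB hn₀
  have := hp.length_eq
  simp at this ⊢
  omega

theorem isCyclic_of_forall (hE : IsPatternEquiv E) [Infinite M]
    (h : ∀ n, ∃ (x : M) (B : List M), B.length = n ∧ E (x :: B) (B ++ [x])) : IsCyclic E := by
  intro x₀ B₀ hn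
  obtain ⟨x, B, hB, hx⟩ := h B₀.length
  obtain ⟨f, hf, hinj⟩ := exists_relabel (hE.nodup hx) hn (by simp [hB])
  have h' := hE.map f hinj hx
  rw [hf] at h'
  simp only [List.map_cons, List.cons.injEq] at hf
  simpa [hf.1, hf.2] using h'

theorem isFull_of_isCyclic_of_swapAt (hE : IsPatternEquiv E)
    (hc : IsCyclic E) (h : SwapAt E 0) : IsFull E := by
  refine hE.isFull_of_swapAt fun i u x y B _ hn => ?_
  have h1 := hE.cyclic_append hc u (x :: y :: B) hn
  have hn1 := (hE.perm h1).nodup_iff.1 hn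
  have h2 := h [] x y (B ++ u) rfl (by simpa using hn1)
  have hn2 := (hE.perm h2).nodup_iff.1 (by simpa using hn1)
  have h3 := hE.cyclic_append hc (y :: x :: B) u (by simpa using hn2)
  exact hE.trans h1 (hE.trans (by simpa using h2) h3)

end IsPatternEquiv

end PatternEquiv

section Orders

variable {M : Type w} {E : List M → List M → Prop} {r s t : M → M → Prop} {a : ℕ → M}

/-- Sorting a finite set by `r` and by `s` always yields related lists. -/
def OrderEquiv (E : List M → List M → Prop) (r s : M → M → Prop) : Prop :=
  ∀ l l' : List M, l.Perm l' → l.Pairwise r → l'.Pairwise s → E l l'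

theorem OrderEquiv.swap (h : OrderEquiv E r s) : OrderEquiv (revRel E) (swap r) (swap s) :=
  fun l l' hp hl hl' => h _ _ ((l.reverse_perm.trans hp).trans l'.reverse_perm.symm)
    (List.pairwise_reverse.2 hl) (List.pairwise_reverse.2 hl')

theorem IsPatternEquiv.orderEquiv_symm (hE : IsPatternEquiv E) (h : OrderEquiv E r s) :
    OrderEquiv E s r :=
  fun l l' hp hl hl' => hE.symm (h l' l hp.symm hl' hl)

theorem IsPatternEquiv.orderEquiv_trans (hE : IsPatternEquiv E) [IsStrictTotalOrder M r]
    [IsStrictTotalOrder M s] (h : OrderEquiv E r s) (h' : OrderEquiv E s t) :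
    OrderEquiv E r t := fun l l' hp hl hl' => by
  obtain ⟨m, hm, hms⟩ := exists_sorted_perm s (nodup_of_pairwise hl)
  exact hE.trans (h l m hm hl hms) (h' m l' (hm.symm.trans hp) hms hl')

/-- The sequence `a` is increasing for both `r` and `s`, or decreasing for both. -/
def Agree (r s : M → M → Prop) (a : ℕ → M) : Prop :=
  (∀ m n, m < n → r (a m) (a n) ∧ s (a m) (a n)) ∨ (∀ m n, m < n → r (a n) (a m) ∧ s (a n) (a m))

theorem Agree.swap (h : Agree r s a) : Agree (swap r) (swap s) a := Or.symm h

theorem Agree.symm (h : Agree r s a) : Agree s r a :=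
  h.imp (fun h m n hmn => (h m n hmn).symm) fun h m n hmn => (h m n hmn).symm

theorem Agree.exists_block (h : Agree r s a) (N b : ℕ) :
    ∃ B : List M, B.length = b ∧ (∀ z ∈ B, ∃ n, N ≤ n ∧ z = a n) ∧ B.Pairwise r ∧
      B.Pairwise s := by
  have hm : ∀ z ∈ (List.range' N b).map a, ∃ n, N ≤ n ∧ z = a n := by
    intro z hz
    obtain ⟨n, hn, rfl⟩ := List.mem_map.1 hz
    exact ⟨n, (List.mem_range'_1.1 hn).1, rfl⟩
  have hl : (List.range' N b).Pairwise (· < ·) := List.pairwise_lt_range'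
  rcases h with h | h
  · refine ⟨(List.range' N b).map a, by simp, hm, ?_, ?_⟩
    · exact List.pairwise_map.2 (hl.imp fun hmn => (h _ _ hmn).1)
    · exact List.pairwise_map.2 (hl.imp fun hmn => (h _ _ hmn).2)
  · refine ⟨((List.range' N b).map a).reverse, by simp, by simpa only [List.mem_reverse] using hm,
      ?_, ?_⟩
    · exact List.pairwise_reverse.2 (List.pairwise_map.2 (hl.imp fun hmn => (h _ _ hmn).1))
    · exact List.pairwise_reverse.2 (List.pairwise_map.2 (hl.imp fun hmn => (h _ _ hmn).2))

theorem Agree.eventually_or [IsStrictTotalOrder M r] (h : Agree r s a) (x : M) :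
    (∀ᶠ n in atTop, r x (a n)) ∨ ∀ᶠ n in atTop, r (a n) x := by
  rcases h with h | h
  · by_cases hx : ∃ m, r x (a m)
    · obtain ⟨m, hm⟩ := hx
      refine .inl ?_
      filter_upwards [eventually_gt_atTop m] with n hn using _root_.trans hm (h m n hn).1
    · push Not at hx
      refine .inr (Eventually.of_forall fun n => ?_)
      rcases trichotomous_of r (a n) x with h1 | h1 | h1
      · exact h1
      · exact absurd (h1 ▸ (h n (n + 1) n.lt_succ_self).1) (hx _)
      · exact absurd h1 (hx _)
  · by_cases hx : ∃ m, r (a m) x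
    · obtain ⟨m, hm⟩ := hx
      refine .inr ?_
      filter_upwards [eventually_gt_atTop m] with n hn using _root_.trans (h m n hn).1 hm
    · push Not at hx
      refine .inl (Eventually.of_forall fun n => ?_)
      rcases trichotomous_of r (a n) x with h1 | h1 | h1
      · exact absurd h1 (hx _)
      · exact absurd (h1 ▸ (h n (n + 1) n.lt_succ_self).1) (hx _)
      · exact h1

theorem Agree.tailEquiv [IsStrictTotalOrder M r] (hE : IsPatternEquiv E) (hrs : OrderEquiv E r s)
    (ha : Agree r s a) {S S' : List M} (hp : S.Perm S') (hS : S.Pairwise r) (hS' : S'.Pairwise s)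
    (hr : ∀ x ∈ S, ∀ᶠ n in atTop, r x (a n)) (hs : ∀ x ∈ S, ∀ᶠ n in atTop, s x (a n)) :
    TailEquiv E S S' := by
  intro B hB
  have hev : ∀ᶠ n in atTop, ∀ x ∈ S, r x (a n) ∧ s x (a n) :=
    (List.finite_toSet S).eventually_all.2 fun x hx => (hr x hx).and (hs x hx)
  obtain ⟨N, hN⟩ := eventually_atTop.1 hev
  obtain ⟨A, hA, hmem, hAr, hAs⟩ := ha.exists_block N B.length
  have h1 : (S ++ A).Pairwise r := List.pairwise_append.2 ⟨hS, hAr, fun x hx y hy => by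
    obtain ⟨n, hn, rfl⟩ := hmem y hy
    exact (hN n hn x hx).1⟩
  have h2 : (S' ++ A).Pairwise s := List.pairwise_append.2 ⟨hS', hAs, fun x hx y hy => by
    obtain ⟨n, hn, rfl⟩ := hmem y hy
    exact (hN n hn x (hp.mem_iff.2 hx)).2⟩
  have h3 := hrs _ _ (hp.append_right A) h1 h2
  obtain ⟨f, hf, hinj⟩ := exists_relabel (hE.nodup h3) hB (by simp [hA])
  have h4 := hE.map f hinj h3
  rw [hf, List.map_append] at h4
  rw [List.map_append] at hf
  obtain ⟨h5, h6⟩ := List.append_inj hf (by simp)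
  have h7 : S'.map f = S' := by
    have : ∀ x ∈ S, f x = id x := List.map_inj_left.1 (by simpa using h5)
    simpa using List.map_congr_left (l := S') (f := f) (g := id)
      fun x hx => this x (hp.mem_iff.2 hx)
  rwa [h6, h7] at h4

theorem Agree.isCyclic [Infinite M] [IsStrictTotalOrder M r] (hE : IsPatternEquiv E)
    (hrs : OrderEquiv E r s) (ha : Agree r s a) {x : M} (hr : ∀ᶠ n in atTop, r x (a n))
    (hs : ∀ᶠ n in atTop, s (a n) x) : IsCyclic E := by
  refine hE.isCyclic_of_forall fun b => ?_
  obtain ⟨N, hN⟩ := eventually_atTop.1 (hr.and hs)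
  obtain ⟨A, hA, hmem, hAr, hAs⟩ := ha.exists_block N b
  refine ⟨x, A, hA, hrs _ _ (List.perm_append_singleton x A).symm ?_ ?_⟩
  · refine List.pairwise_cons.2 ⟨fun y hy => ?_, hAr⟩
    obtain ⟨n, hn, rfl⟩ := hmem y hy
    exact (hN n hn).1
  · refine List.pairwise_append.2 ⟨hAs, List.pairwise_singleton _ _, fun y hy z hz => ?_⟩
    obtain ⟨n, hn, rfl⟩ := hmem y hy
    rw [List.mem_singleton.1 hz]
    exact (hN n hn).2

/-- In the absence of rotations, the two orders have the same cut along the sequence. -/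
theorem Agree.eventually_of_not_isCyclic [Infinite M] [IsStrictTotalOrder M r]
    [IsStrictTotalOrder M s] (hE : IsPatternEquiv E)
    (hc : ¬ IsCyclic E) (hrs : OrderEquiv E r s) (ha : Agree r s a) {x : M}
    (hr : ∀ᶠ n in atTop, r x (a n)) : ∀ᶠ n in atTop, s x (a n) :=
  (ha.symm.eventually_or x).resolve_right fun h => hc (ha.isCyclic hE hrs hr h)

section Cut

/-- The order `F + I`, where `F` is the complement of `I`. -/
def cutOf (r : M → M → Prop) (I : Set M) : M → M → Prop := fun a b =>
  (a ∉ I ∧ b ∉ I ∧ r a b) ∨ (a ∈ I ∧ b ∈ I ∧ r a b) ∨ (a ∉ I ∧ b ∈ I)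

theorem cutOf_isStrictTotalOrder [IsStrictTotalOrder M r] (I : Set M) :
    IsStrictTotalOrder M (cutOf r I) where
  trichotomous x y h h' := by
    have := trichotomous_of r x y
    simp only [cutOf] at h h'
    tauto
  irrefl x h := by
    have := irrefl_of r x
    simp only [cutOf] at h
    tauto
  trans x y z h h' := by
    have : r x y → r y z → r x z := _root_.trans
    simp only [cutOf] at h h' ⊢
    tauto

theorem orderEquiv_cutOf [IsStrictTotalOrder M r] (hE : IsPatternEquiv E) (hc : IsCyclic E)
    {I : Set M} (hI : ∀ x y, r x y → y ∈ I → x ∈ I) : OrderEquiv E r (cutOf r I) := by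
  classical
  intro l l' hp hl hl'
  have hr : ∀ x y, x ∈ I → y ∉ I → r x y := fun x y hx hy => by
    rcases trichotomous_of r x y with h | h | h
    · exact h
    · exact absurd (h ▸ hx) hy
    · exact absurd (hI _ _ h hx) hy
  have := cutOf_isStrictTotalOrder (r := r) I
  have hperm : (l.filter (· ∈ I) ++ l.filter (· ∉ I)).Perm l := by
    simpa using List.filter_append_perm (fun x => decide (x ∈ I)) l
  have h1 : l = l.filter (· ∈ I) ++ l.filter (· ∉ I) := by
    refine eq_of_perm_of_pairwise hperm.symm hl (List.pairwise_append.2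
      ⟨hl.filter _, hl.filter _, fun x hx y hy => hr x y ?_ ?_⟩)
    · simpa using (List.mem_filter.1 hx).2
    · simpa using (List.mem_filter.1 hy).2
  have h2 : l' = l.filter (· ∉ I) ++ l.filter (· ∈ I) := by
    refine eq_of_perm_of_pairwise (hp.symm.trans (hperm.symm.trans List.perm_append_comm)) hl'
      (List.pairwise_append.2 ⟨?_, ?_, fun x hx y hy => .inr (.inr ⟨?_, ?_⟩)⟩)
    · refine (hl.filter _).imp_of_mem fun {x y} hx hy h => .inl ⟨?_, ?_, h⟩
      · simpa using (List.mem_filter.1 hx).2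
      · simpa using (List.mem_filter.1 hy).2
    · refine (hl.filter _).imp_of_mem fun {x y} hx hy h => .inr (.inl ⟨?_, ?_, h⟩)
      · simpa using (List.mem_filter.1 hx).2
      · simpa using (List.mem_filter.1 hy).2
    · simpa using (List.mem_filter.1 hx).2
    · simpa using (List.mem_filter.1 hy).2
  have h3 := hE.cyclic_append hc (l.filter (· ∈ I)) (l.filter (· ∉ I))
    (hperm.nodup_iff.2 (nodup_of_pairwise hl))
  rwa [← h1, ← h2] at h3

/-- An order is recovered from its rotation at an initial segment by rotating back. -/
theorem rel_iff_of_cutOf [IsStrictTotalOrder M r] {I : Set M}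
    (hI : ∀ x y, r x y → y ∈ I → x ∈ I) (x y : M) :
    r x y ↔ (x ∈ I ∧ y ∉ I) ∨ ((x ∈ I ↔ y ∈ I) ∧ cutOf r I x y) := by
  have h1 := hI x y
  have h2 := hI y x
  have h3 := trichotomous_of r x y
  have h4 : x = y → (x ∈ I ↔ y ∈ I) := fun e => by rw [e]
  simp only [cutOf]
  tauto

/-- If rotations of `r` and `s` at initial segments coincide, then `s` is a rotation of `r`. -/
theorem exists_cutOf_eq [IsStrictTotalOrder M r] [IsStrictTotalOrder M s] {I J : Set M}
    (hI : ∀ x y, r x y → y ∈ I → x ∈ I) (hJ : ∀ x y, s x y → y ∈ J → x ∈ J)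
    (h : ∀ x y, cutOf r I x y ↔ cutOf s J x y) :
    ∃ K : Set M, (∀ x y, r x y → y ∈ K → x ∈ K) ∧ ∀ x y, s x y ↔ cutOf r K x y := by
  have hr := rel_iff_of_cutOf hI
  have hs := rel_iff_of_cutOf hJ
  have hrI : ∀ x y, x ∉ I → y ∈ I → cutOf r I x y := fun x y hx hy => .inr (.inr ⟨hx, hy⟩)
  have hrI' : ∀ x y, x ∉ I → y ∈ I → ¬ cutOf r I y x := fun x y hx hy => by
    simp only [cutOf]; tauto
  have hsJ : ∀ x y, x ∉ J → y ∈ J → cutOf r I x y := fun x y hx hy =>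
    (h x y).2 (.inr (.inr ⟨hx, hy⟩))
  have hsJ' : ∀ x y, x ∉ J → y ∈ J → ¬ cutOf r I y x := fun x y hx hy => by
    rw [h]; simp only [cutOf]; tauto
  simp only [← h] at hs
  generalize cutOf r I = t at hr hs hrI hrI' hsJ hsJ'
  have hnest : I ⊆ J ∨ J ⊆ I := by
    by_contra! hcon
    obtain ⟨⟨x, hx, hx'⟩, ⟨y, hy, hy'⟩⟩ :=
      And.intro (Set.not_subset.1 hcon.1) (Set.not_subset.1 hcon.2)
    exact hsJ' x y hx' hy (hrI y x hy' hx)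
  rcases hnest with hsub | hsub
  · refine ⟨{x | x ∈ I ∨ x ∉ J}, fun x y hxy hy => ?_, fun x y => ?_⟩
    · have := hr x y; have := hsJ' y x
      simp only [Set.mem_ofPred_eq] at hy ⊢
      tauto
    · have := @hsub x; have := @hsub y
      have := hrI x y; have := hrI' x y; have := hsJ x y; have := hsJ' x y
      have := hrI y x; have := hrI' y x; have := hsJ y x; have := hsJ' y x
      simp only [cutOf, Set.mem_ofPred_eq, hr x y, hs x y]
      clear hI hJ h hr hs hrI hrI' hsJ hsJ' hsub
      by_cases x ∈ I <;> by_cases y ∈ I <;> by_cases x ∈ J <;> by_cases y ∈ J <;> simp_all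
  · refine ⟨{x | x ∈ I ∧ x ∉ J}, fun x y hxy hy => ?_, fun x y => ?_⟩
    · have := hr x y; have := hsJ' y x
      simp only [Set.mem_ofPred_eq] at hy ⊢
      tauto
    · have := @hsub x; have := @hsub y
      have := hrI x y; have := hrI' x y; have := hsJ x y; have := hsJ' x y
      have := hrI y x; have := hrI' y x; have := hsJ y x; have := hsJ' y x
      simp only [cutOf, Set.mem_ofPred_eq, hr x y, hs x y]
      clear hI hJ h hr hs hrI hrI' hsJ hsJ' hsub
      by_cases x ∈ I <;> by_cases y ∈ I <;> by_cases x ∈ J <;> by_cases y ∈ J <;> simp_all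

theorem mem_below_of_rel [IsStrictTotalOrder M r] {x y : M} (hxy : r x y)
    (hy : ∀ᶠ n in atTop, r y (a n)) : ∀ᶠ n in atTop, r x (a n) :=
  hy.mono fun _ h => _root_.trans hxy h

theorem exists_cutOf_of_increasing [Infinite M] [IsStrictTotalOrder M r] [IsStrictTotalOrder M s]
    (hE : IsPatternEquiv E) (hc : IsCyclic E) (hf : ¬ IsFull E) (hrs : OrderEquiv E r s)
    (ha : ∀ m n, m < n → r (a m) (a n) ∧ s (a m) (a n)) :
    ∃ K : Set M, (∀ x y, r x y → y ∈ K → x ∈ K) ∧ ∀ x y, s x y ↔ cutOf r K x y := by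
  set I : Set M := {x | ∀ᶠ n in atTop, r x (a n)} with hI
  set J : Set M := {x | ∀ᶠ n in atTop, s x (a n)} with hJ
  have hIi : ∀ x y, r x y → y ∈ I → x ∈ I := fun x y => mem_below_of_rel
  have hJi : ∀ x y, s x y → y ∈ J → x ∈ J := fun x y => mem_below_of_rel
  have haI : ∀ m, a m ∈ I := fun m => by
    filter_upwards [eventually_gt_atTop m] with n hn using (ha m n hn).1
  have haJ : ∀ m, a m ∈ J := fun m => by
    filter_upwards [eventually_gt_atTop m] with n hn using (ha m n hn).2
  have := cutOf_isStrictTotalOrder (r := r) I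
  have := cutOf_isStrictTotalOrder (r := s) J
  have htot : ∀ (t : M → M → Prop) [IsStrictTotalOrder M t] {x y : M}, x ≠ y → ¬ t x y → t y x :=
    fun t _ x y hne hxy => ((trichotomous_of t x y).resolve_left hxy).resolve_left hne
  have hequiv : OrderEquiv E (cutOf r I) (cutOf s J) :=
    hE.orderEquiv_trans (hE.orderEquiv_symm (orderEquiv_cutOf hE hc hIi))
      (hE.orderEquiv_trans hrs (orderEquiv_cutOf hE hc hJi))
  have hag : Agree (cutOf r I) (cutOf s J) a := .inl fun m n hmn =>
    ⟨.inr (.inl ⟨haI m, haI n, (ha m n hmn).1⟩), .inr (.inl ⟨haJ m, haJ n, (ha m n hmn).2⟩)⟩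
  have hbr : ∀ z, ∀ᶠ n in atTop, cutOf r I z (a n) := fun z => by
    by_cases hz : z ∈ I
    · exact Eventually.mono hz fun n hn => .inr (.inl ⟨hz, haI n, hn⟩)
    · exact Eventually.of_forall fun n => .inr (.inr ⟨hz, haI n⟩)
  have hbs : ∀ z, ∀ᶠ n in atTop, cutOf s J z (a n) := fun z => by
    by_cases hz : z ∈ J
    · exact Eventually.mono hz fun n hn => .inr (.inl ⟨hz, haJ n, hn⟩)
    · exact Eventually.of_forall fun n => .inr (.inr ⟨hz, haJ n⟩)
  have hle : ∀ x y, cutOf r I x y → cutOf s J x y := fun x y hxy => by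
    by_contra hxy'
    have hne : x ≠ y := fun e => irrefl_of (cutOf r I) x (by rwa [← e] at hxy)
    have htail : TailEquiv E [x, y] [y, x] := hag.tailEquiv hE hequiv (.swap y x [])
      (by simpa using hxy) (by simpa using htot _ hne hxy') (fun z _ => hbr z) (fun z _ => hbs z)
    exact hf (hE.isFull_of_isCyclic_of_swapAt hc
      (hE.swapAt_of_tailEquiv (u := [x]) (v := []) (w := []) htail (by simpa using hne) rfl))
  refine exists_cutOf_eq hIi hJi fun x y => ⟨hle x y, fun hxy => ?_⟩
  by_contra hxy'
  have hne : x ≠ y := fun e => irrefl_of (cutOf s J) x (by rwa [← e] at hxy)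
  exact asymm_of (cutOf s J) hxy (hle y x (htot _ hne hxy'))

theorem exists_cutOf [Infinite M] [IsStrictTotalOrder M r] [IsStrictTotalOrder M s]
    (hE : IsPatternEquiv E) (hc : IsCyclic E) (hf : ¬ IsFull E) (hrs : OrderEquiv E r s)
    (ha : Agree r s a) :
    ∃ K : Set M, (∀ x y, r x y → y ∈ K → x ∈ K) ∧ ∀ x y, s x y ↔ cutOf r K x y := by
  rcases ha with ha | ha
  · exact exists_cutOf_of_increasing hE hc hf hrs ha
  · obtain ⟨K, hK, h⟩ := exists_cutOf_of_increasing hE.rev (hE.isCyclic_rev hc)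
      (fun h => hf h.of_rev) hrs.swap ha
    refine ⟨Kᶜ, fun x y hxy hy hx => hy (hK y x hxy hx), fun x y => ?_⟩
    have := h y x
    simp only [swap, cutOf] at this
    simp only [cutOf, Set.mem_compl_iff]
    tauto

end Cut

section Triple

variable {p q : ℕ}

/-- The elements with fewer than `p` predecessors. -/
def initialBlock (r : M → M → Prop) (p : ℕ) : Set M := {x | {y | r y x}.encard < p}

theorem mem_initialBlock_of_rel [IsStrictTotalOrder M r] {x y : M} (hxy : r x y)
    (hy : y ∈ initialBlock r p) : x ∈ initialBlock r p :=
  lt_of_le_of_lt (Set.encard_le_encard fun _ hz => _root_.trans (r := r) hz hxy) hy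

theorem length_le_of_pairwise_initialBlock [IsStrictTotalOrder M r] {l : List M}
    (hl : l.Pairwise r) (hmem : ∀ x ∈ l, x ∈ initialBlock r p) : l.length ≤ p := by
  classical
  rcases List.eq_nil_or_concat l with rfl | ⟨m, x, rfl⟩
  · simp
  · rw [List.concat_eq_append] at hl hmem ⊢
    have hx : {y | r y x}.encard < p := hmem x (by simp)
    have hm := (List.pairwise_append.1 hl)
    have hsub : (m.toFinset : Set M) ⊆ {y | r y x} := fun y hy =>
      hm.2.2 y (by simpa using hy) x (by simp)
    have h1 := (Set.encard_le_encard hsub).trans_lt hx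
    rw [Set.encard_coe_eq_coe_finsetCard, List.toFinset_card_of_nodup (nodup_of_pairwise hm.1)] at h1
    have : m.length < p := by exact_mod_cast h1
    simpa using this

theorem finite_initialBlock [IsStrictTotalOrder M r] : (initialBlock r p).Finite := by
  by_contra hinf
  obtain ⟨t, ht, hcard⟩ := Set.Infinite.exists_subset_card_eq hinf (p + 1)
  obtain ⟨l, hl, hls⟩ := exists_sorted_perm r t.nodup_toList
  have := length_le_of_pairwise_initialBlock hls fun x hx =>
    ht (by simpa using hl.mem_iff.2 hx)
  rw [← hl.length_eq, Finset.length_toList, hcard] at this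
  omega

/-- Below the cut given by the sequence, `s` agrees with `r` as soon as the larger element lies
outside the initial block. -/
theorem Agree.rel_of_not_mem_initialBlock [Infinite M] [IsStrictTotalOrder M r]
    [IsStrictTotalOrder M s] (hE : IsPatternEquiv E) (hc : ¬ IsCyclic E) (hp : ¬ SwapAt E p)
    (hrs : OrderEquiv E r s) (ha : Agree r s a) {x y : M} (hyx : r y x)
    (hx : ∀ᶠ n in atTop, r x (a n)) (hxp : x ∉ initialBlock r (p + 1)) : s y x := by
  classical
  have hcard : ((p + 1 : ℕ) : ℕ∞) ≤ {z | r z x}.encard := not_lt.1 hxp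
  obtain ⟨t, hyt, htx, htc⟩ := Set.exists_superset_subset_encard_eq
    (s := {y}) (t := {z | r z x}) (k := ((p + 1 : ℕ) : ℕ∞))
    (by simpa using hyx) (by simp) hcard
  have htf : t.Finite := Set.finite_of_encard_eq_coe htc
  obtain ⟨u, hu, hus⟩ := exists_sorted_perm r htf.toFinset.nodup_toList
  have hmem : ∀ z, z ∈ u ↔ z ∈ t := fun z => by rw [← hu.mem_iff]; simp
  have hlen : u.length = p + 1 := by
    rw [← hu.length_eq, Finset.length_toList]
    rw [htf.encard_eq_coe_toFinset_card] at htc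
    exact_mod_cast htc
  have hsorted : (u ++ [x]).Pairwise r := List.pairwise_append.2
    ⟨hus, List.pairwise_singleton _ _, fun z hz w hw => by
      rw [List.mem_singleton.1 hw]
      exact htx ((hmem z).1 hz)⟩
  have hnd := nodup_of_pairwise hsorted
  obtain ⟨l', hl', hls⟩ := exists_sorted_perm s hnd
  have hbelow : ∀ z ∈ u ++ [x], ∀ᶠ n in atTop, r z (a n) := fun z hz => by
    rcases List.mem_append.1 hz with hz | hz
    · exact mem_below_of_rel (htx ((hmem z).1 hz)) hx
    · rwa [List.mem_singleton.1 hz]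
  have htail := ha.tailEquiv hE hrs hl' hsorted hls hbelow fun z hz =>
    ha.eventually_of_not_isCyclic hE hc hrs (hbelow z hz)
  obtain ⟨v, w, rfl⟩ := List.append_of_mem (hl'.mem_iff.1 (by simp : x ∈ u ++ [x]))
  rcases List.eq_nil_or_concat w with rfl | ⟨w, z, rfl⟩
  · have hyv : y ∈ v := by
      have h1 : y ∈ v ++ [x] := hl'.mem_iff.1
        (List.mem_append_left _ ((hmem y).2 (hyt rfl)))
      rcases List.mem_append.1 h1 with h | h
      · exact h
      · rw [List.mem_singleton.1 h] at hyx
        exact absurd hyx (irrefl_of r x)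
    exact (List.pairwise_append.1 hls).2.2 y hyv x (by simp)
  · rw [List.concat_eq_append] at htail
    exact absurd (hE.swapAt_of_tailEquiv htail hnd hlen) hp

/-- The two orders agree on pairs not contained in an end block. -/
theorem Agree.rel_of_rel [Infinite M] [IsStrictTotalOrder M r] [IsStrictTotalOrder M s]
    (hE : IsPatternEquiv E) (hc : ¬ IsCyclic E) (hp : ¬ SwapAt E p) (hq : ¬ SwapAt (revRel E) q)
    (hrs : OrderEquiv E r s) (ha : Agree r s a) {x y : M} (hxy : r x y)
    (hy : y ∉ initialBlock r (p + 1)) (hx : x ∉ initialBlock (Function.swap r) (q + 1)) :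
    s x y := by
  have hc' : ¬ IsCyclic (revRel E) := fun h => hc (by
    simpa only [revRel_revRel] using hE.rev.isCyclic_rev h)
  rcases ha.eventually_or y with hly | hly
  · exact ha.rel_of_not_mem_initialBlock hE hc hp hrs hxy hly hy
  rcases ha.eventually_or x with hlx | hlx
  · have h1 := ha.eventually_of_not_isCyclic hE hc hrs hlx
    have h2 := ha.swap.eventually_of_not_isCyclic hE.rev hc' hrs.swap hly
    obtain ⟨n, hn, hn'⟩ := (h1.and h2).exists
    exact _root_.trans hn hn'
  · exact ha.swap.rel_of_not_mem_initialBlock hE.rev hc' hq hrs.swap hxy hlx hx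

/-- Orders that differ from `r` only inside the end blocks are equivalent to `r`. -/
theorem orderEquiv_of_rel_of_rel [IsStrictTotalOrder M r] [IsStrictTotalOrder M s]
    (hE : IsPatternEquiv E) (hp : ∀ i, i + 1 < p → SwapAt E i)
    (hq : ∀ i, i + 1 < q → SwapAt (revRel E) i)
    (hdisj : Disjoint (initialBlock r p) (initialBlock (Function.swap r) q))
    (h : ∀ x y, r x y → ¬ (x ∈ initialBlock r p ∧ y ∈ initialBlock r p) →
      ¬ (x ∈ initialBlock (Function.swap r) q ∧ y ∈ initialBlock (Function.swap r) q) → s x y) :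
    OrderEquiv E r s := by
  classical
  set K := initialBlock r p with hK
  set H := initialBlock (Function.swap r) q with hH
  have hKi : ∀ x y, r x y → y ∈ K → x ∈ K := fun x y => mem_initialBlock_of_rel
  have hHi : ∀ x y, r x y → x ∈ H → y ∈ H := fun x y hxy hx =>
    mem_initialBlock_of_rel (r := Function.swap r) hxy hx
  have hKH : ∀ x, x ∈ K → x ∉ H := fun x hx hx' => Set.disjoint_left.1 hdisj hx hx'
  have hKr : ∀ x y, x ∈ K → y ∉ K → r x y := fun x y hx hy => by
    rcases trichotomous_of r x y with h | h | h
    · exact h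
    · exact absurd (h ▸ hx) hy
    · exact absurd (hKi _ _ h hx) hy
  have hHr : ∀ x y, x ∉ H → y ∈ H → r x y := fun x y hx hy => by
    rcases trichotomous_of r x y with h | h | h
    · exact h
    · exact absurd (h ▸ hy) hx
    · exact absurd (hHi _ _ h hy) hx
  intro l l' hperm hl hl'
  have split : ∀ m : List M, m.Perm (m.filter (· ∈ K) ++
      (m.filter (fun x => x ∉ K ∧ x ∉ H) ++ m.filter (· ∈ H))) := fun m => by
    have h1 : m.Perm (m.filter (· ∈ K) ++ m.filter (fun x => !decide (x ∈ K))) :=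
      (List.filter_append_perm (fun x => decide (x ∈ K)) m).symm
    refine h1.trans (List.Perm.append_left _ ?_)
    have h2 := (List.filter_append_perm (fun x => !decide (x ∈ H))
      (m.filter (fun x => !decide (x ∈ K)))).symm
    refine h2.trans (List.Perm.of_eq ?_)
    rw [List.filter_filter, List.filter_filter]
    congr 1
    · exact List.filter_congr fun x _ => by simp [Bool.and_comm]
    · exact List.filter_congr fun x _ => by
        have := hKH x
        by_cases x ∈ K <;> by_cases x ∈ H <;> simp_all
  have eqs : ∀ (t : M → M → Prop) [IsStrictTotalOrder M t]
      (_ : ∀ x y, r x y → ¬ (x ∈ K ∧ y ∈ K) → ¬ (x ∈ H ∧ y ∈ H) → t x y) (m : List M),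
      m.Pairwise t → m = m.filter (· ∈ K) ++
      (m.filter (fun x => x ∉ K ∧ x ∉ H) ++ m.filter (· ∈ H)) := by
    intro t _ ht m hm
    refine eq_of_perm_of_pairwise (split m) hm (List.pairwise_append.2 ⟨hm.filter _,
      List.pairwise_append.2 ⟨hm.filter _, hm.filter _, fun x hx y hy => ?_⟩, fun x hx y hy => ?_⟩)
    · simp only [List.mem_filter, decide_eq_true_eq] at hx hy
      have h1 := hKH y
      exact ht x y (hHr x y hx.2.2 hy.2) (fun h => hx.2.1 h.1) (fun h => hx.2.2 h.1)
    · simp only [List.mem_append, List.mem_filter, decide_eq_true_eq] at hx hy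
      have hyK : y ∉ K := by
        rcases hy with hy | hy
        · exact hy.2.1
        · exact fun h => hKH y h hy.2
      exact ht x y (hKr x y hx.2 hyK) (fun h => hyK h.2) (fun h => hKH x hx.2 h.1)
  have e1 := eqs r (fun _ _ h _ _ => h) l hl
  have e2 := eqs s h l' hl'
  have emid : l.filter (fun x => x ∉ K ∧ x ∉ H) = l'.filter (fun x => x ∉ K ∧ x ∉ H) := by
    refine eq_of_perm_of_pairwise (r := s) (hperm.filter _) ?_ (hl'.filter _)
    refine (hl.filter _).imp_of_mem fun {x y} hx hy hxy => ?_
    simp only [List.mem_filter, decide_eq_true_eq] at hx hy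
    exact h x y hxy (fun h => hx.2.1 h.1) (fun h => hx.2.2 h.1)
  rw [← emid] at e2
  have hlK : (l.filter (· ∈ K)).length ≤ p :=
    length_le_of_pairwise_initialBlock (hl.filter _) fun x hx => by
      simpa using (List.mem_filter.1 hx).2
  have hlH : (l.filter (· ∈ H)).length ≤ q := by
    rw [← List.length_reverse]
    refine length_le_of_pairwise_initialBlock (r := Function.swap r)
      (List.pairwise_reverse.2 (hl.filter _)) fun x hx => ?_
    simpa using (List.mem_filter.1 (List.mem_reverse.1 hx)).2
  have hn : l.Nodup := nodup_of_pairwise hl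
  have s1 := hE.of_swapAt hp (hperm.filter (· ∈ K)) []
    (l.filter (fun x => x ∉ K ∧ x ∉ H) ++ l.filter (· ∈ H)) (by simpa using hlK)
    (by rw [List.nil_append, ← e1]; exact hn)
  simp only [List.nil_append] at s1
  have hn2 := (hE.perm s1).nodup_iff.1 (by rw [← e1]; exact hn)
  have s2 := hE.rev.of_swapAt hq (l := (l.filter (· ∈ H)).reverse)
    (l' := (l'.filter (· ∈ H)).reverse)
    (((List.reverse_perm _).trans (hperm.filter (· ∈ H))).trans (List.reverse_perm _).symm) []
    ((l'.filter (· ∈ K)) ++ (l.filter (fun x => x ∉ K ∧ x ∉ H))).reverse (by simpa using hlH)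
    (by
      rw [← List.nodup_reverse]
      simpa using hn2)
  simp only [revRel, List.nil_append, List.reverse_append, List.reverse_reverse,
    List.append_assoc] at s2
  have s3 := hE.trans s1 s2
  rwa [← e1, ← e2] at s3

end Triple
end Orders

section Chains

open FirstOrder.Language

variable (L : FirstOrder.Language.{u, v}) {M : Type w} [L.Structure M]

/-- Every relation of the structure depends only on the order type of the tuple. -/
def TypeInvariant (r : M → M → Prop) : Prop :=
  ∀ (m : ℕ) (R : L.Relations m) (v w : Fin m → M),
    (∀ i j, r (v i) (v j) ↔ r (w i) (w j)) → (Structure.RelMap R v ↔ Structure.RelMap R w)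

variable {L}

theorem TypeInvariant.swap {r : M → M → Prop} (h : TypeInvariant L r) :
    TypeInvariant L (Function.swap r) :=
  fun m R v w hvw => h m R v w fun i j => hvw j i

theorem exists_realize_eq {m : ℕ} (t : FirstOrder.Language.order.Term (Fin m ⊕ Fin 0)) :
    ∃ i : Fin m, ∀ (S : FirstOrder.Language.order.Structure M) (v : Fin m → M) (x : Fin 0 → M),
      @Term.realize _ M S _ (Sum.elim v x) t = v i := by
  match t with
  | .var (.inl i) => exact ⟨i, fun _ _ _ => rfl⟩
  | .var (.inr i) => exact i.elim0
  | .func f _ => exact isEmptyElim f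

theorem realize_iff_of_isQF (lo : LinearOrder M) {m : ℕ}
    {φ : FirstOrder.Language.order.Formula (Fin m)} (hφ : φ.IsQF) {v w : Fin m → M}
    (h : ∀ i j, lo.lt (v i) (v j) ↔ lo.lt (w i) (w j)) :
    @Formula.Realize _ _ (ltStructure lo) _ φ v ↔ @Formula.Realize _ _ (ltStructure lo) _ φ w := by
  let := ltStructure lo
  unfold Formula.Realize
  have heq : ∀ i j, v i = v j ↔ w i = w j := fun i j => by
    have h1 := h i j
    have h2 := h j i
    have key : ∀ x y : M, x = y ↔ ¬ lo.lt x y ∧ ¬ lo.lt y x := fun x y =>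
      ⟨by rintro rfl; exact ⟨lt_irrefl _, lt_irrefl _⟩,
        fun h => le_antisymm (not_lt.1 h.2) (not_lt.1 h.1)⟩
    rw [key, key, h1, h2]
  induction hφ with
  | falsum => exact Iff.rfl
  | of_isAtomic hat =>
    cases hat with
    | equal t₁ t₂ =>
      obtain ⟨i, hi⟩ := exists_realize_eq (M := M) t₁
      obtain ⟨j, hj⟩ := exists_realize_eq (M := M) t₂
      simp only [BoundedFormula.realize_bdEqual, hi, hj]
      exact heq i j
    | @rel l R ts =>
      match l, R with
      | 2, .le =>
        obtain ⟨i, hi⟩ := exists_realize_eq (M := M) (ts 0)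
        obtain ⟨j, hj⟩ := exists_realize_eq (M := M) (ts 1)
        have key : ∀ x : Fin m → M, BoundedFormula.Realize
            (Relations.boundedFormula (L := FirstOrder.Language.order) (.le : orderRel 2) ts) x
              default ↔ lo.lt (x i) (x j) := fun x => by
          rw [← hi (ltStructure lo) x default, ← hj (ltStructure lo) x default]
          exact Iff.rfl
        exact (key v).trans ((h i j).trans (key w).symm)
  | imp _ _ ih₁ ih₂ =>
    exact imp_congr ih₁ ih₂

theorem isQF_iSup {L' : FirstOrder.Language.{u, v}} {α β : Type*} [Finite β]
    {f : β → L'.Formula α} (h : ∀ b, (f b).IsQF) : (Formula.iSup f).IsQF := by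
  have key : ∀ l : List β, BoundedFormula.IsQF ((l.map f).foldr (· ⊔ ·) ⊥) := fun l => by
    induction l with
    | nil => exact BoundedFormula.isQF_bot
    | cons b l ih => exact (h b).sup ih
  exact key _

theorem isQF_iInf {L' : FirstOrder.Language.{u, v}} {α β : Type*} [Finite β]
    {f : β → L'.Formula α} (h : ∀ b, (f b).IsQF) : (Formula.iInf f).IsQF := by
  have key : ∀ l : List β, BoundedFormula.IsQF ((l.map f).foldr (· ⊓ ·) ⊤) := fun l => by
    induction l with
    | nil => exact BoundedFormula.IsQF.top
    | cons b l ih => exact (h b).inf ih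
  exact key _

/-- The formula expressing that the `i`-th variable is smaller than the `j`-th one. -/
def ltFormula {m : ℕ} (i j : Fin m) : FirstOrder.Language.order.Formula (Fin m) :=
  Relations.formula₂ (L := FirstOrder.Language.order) .le (Term.var i) (Term.var j)

theorem realize_ltFormula (lo : LinearOrder M) {m : ℕ} (i j : Fin m) (v : Fin m → M) :
    @Formula.Realize _ _ (ltStructure lo) _ (ltFormula i j) v ↔ lo.lt (v i) (v j) := by
  exact Iff.rfl

theorem isQF_ltFormula {m : ℕ} (i j : Fin m) : (ltFormula i j).IsQF :=
  (BoundedFormula.IsAtomic.rel _ _).isQF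

open Classical in
theorem exists_formula_of_type {m : ℕ} (τ : Fin m → Fin m → Prop) :
    ∃ φ : FirstOrder.Language.order.Formula (Fin m), φ.IsQF ∧
      ∀ (lo : LinearOrder M) (v : Fin m → M),
        @Formula.Realize _ _ (ltStructure lo) _ φ v ↔ ∀ i j, lo.lt (v i) (v j) ↔ τ i j := by
  refine ⟨Formula.iInf fun p : Fin m × Fin m =>
    if τ p.1 p.2 then ltFormula p.1 p.2 else (ltFormula p.1 p.2).not, isQF_iInf fun p => ?_,
    fun lo v => ?_⟩
  · split_ifs
    · exact isQF_ltFormula _ _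
    · exact (isQF_ltFormula _ _).not
  · let := ltStructure lo
    rw [Formula.realize_iInf, Prod.forall]
    refine forall_congr' fun i => forall_congr' fun j => ?_
    by_cases h : τ i j
    · simp only [h, if_true, iff_true]
      exact realize_ltFormula lo i j v
    · simp only [h, if_false, iff_false, Formula.realize_not]
      exact not_congr (realize_ltFormula lo i j v)

theorem chains_iff_typeInvariant (lo : LinearOrder M) :
    Chains L lo ↔ TypeInvariant L lo.lt := by
  constructor
  · intro h m R v w hvw
    obtain ⟨φ, hφ, hR⟩ := h m R
    rw [hR, hR]
    exact realize_iff_of_isQF lo hφ hvw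
  · intro h m R
    choose φ hφ hreal using fun τ : Fin m → Fin m → Prop => exists_formula_of_type (M := M) τ
    let T : Set (Fin m → Fin m → Prop) :=
      {τ | ∃ w : Fin m → M, Structure.RelMap R w ∧ ∀ i j, lo.lt (w i) (w j) ↔ τ i j}
    refine ⟨Formula.iSup fun τ : T => φ τ, isQF_iSup fun τ => hφ τ, fun v => ?_⟩
    let := ltStructure lo
    rw [Formula.realize_iSup]
    constructor
    · intro hv
      exact ⟨⟨fun i j => lo.lt (v i) (v j), v, hv, fun _ _ => Iff.rfl⟩,
        (hreal _ lo v).2 fun _ _ => Iff.rfl⟩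
    · rintro ⟨⟨τ, w, hw, hτ⟩, hv⟩
      have hv := (hreal τ lo v).1 hv
      exact (h m R w v fun i j => (hτ i j).trans (hv i j).symm).1 hw

variable (L) in
/-- Two arrangements of the same labels are related if placing the labels increasingly according
to either arrangement yields isomorphic labelled structures. -/
def arrangementRel (r : M → M → Prop) (l l' : List M) : Prop :=
  l.Nodup ∧ l.Perm l' ∧ ∀ v w : M → M, (l.map v).Pairwise r → (l'.map w).Pairwise r →
    ∀ (m : ℕ) (R : L.Relations m) (f : Fin m → M), (∀ i, f i ∈ l) →
      (Structure.RelMap R (v ∘ f) ↔ Structure.RelMap R (w ∘ f))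

variable {r s : M → M → Prop}

theorem rel_map_of_pairwise [IsStrictTotalOrder M r] {l : List M} {v w : M → M}
    (hv : (l.map v).Pairwise r) (hw : (l.map w).Pairwise s) {x y : M} (hx : x ∈ l) (hy : y ∈ l)
    (h : r (v x) (v y)) : s (w x) (w y) := by
  induction l with
  | nil => simp at hx
  | cons z l ih =>
    simp only [List.map_cons, List.pairwise_cons, List.forall_mem_map] at hv hw
    rcases List.mem_cons.1 hx with rfl | hx' <;> rcases List.mem_cons.1 hy with rfl | hy'
    · exact absurd h (irrefl_of r _)
    · exact hw.1 y hy'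
    · exact absurd h (asymm_of r (hv.1 x hx'))
    · exact ih hv.2 hw.2 hx' hy'

theorem TypeInvariant.relMap_iff [IsStrictTotalOrder M r] (h : TypeInvariant L r) {l : List M}
    {v w : M → M} (hv : (l.map v).Pairwise r) (hw : (l.map w).Pairwise r) {m : ℕ}
    (R : L.Relations m) {f : Fin m → M} (hf : ∀ i, f i ∈ l) :
    Structure.RelMap R (v ∘ f) ↔ Structure.RelMap R (w ∘ f) :=
  h m R _ _ fun i j => ⟨rel_map_of_pairwise hv hw (hf i) (hf j),
    rel_map_of_pairwise hw hv (hf i) (hf j)⟩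

theorem exists_increasing (r : M → M → Prop) [IsStrictTotalOrder M r] {l : List M}
    (hl : l.Nodup) : ∃ v : M → M, (l.map v).Pairwise r := by
  obtain ⟨l', hp, hs⟩ := exists_sorted_perm r hl
  obtain ⟨f, hf, -⟩ := exists_relabel hl (nodup_of_pairwise hs) hp.length_eq
  exact ⟨f, hf ▸ hs⟩

theorem isPatternEquiv_arrangementRel [Infinite M] [IsStrictTotalOrder M r]
    (h : TypeInvariant L r) : IsPatternEquiv (arrangementRel L r) where
  nodup h := h.1
  perm h := h.2.1
  refl hl := ⟨hl, .refl _, fun _ _ hv hw _ R _ hf => h.relMap_iff hv hw R hf⟩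
  symm := fun ⟨hl, hp, hR⟩ => ⟨hp.nodup_iff.1 hl, hp.symm, fun v w hv hw m R f hf =>
    (hR w v hw hv m R f fun i => hp.mem_iff.2 (hf i)).symm⟩
  trans := fun ⟨hl, hp, hR⟩ ⟨hl', hp', hR'⟩ => ⟨hl, hp.trans hp', fun v w hv hw m R f hf => by
    obtain ⟨x, hx⟩ := exists_increasing r hl'
    exact (hR v x hv hx m R f hf).trans (hR' x w hx hw m R f fun i => hp.mem_iff.1 (hf i))⟩
  filter := fun p ⟨hl, hp, hR⟩ => ⟨hl.filter p, hp.filter p, fun v w hv hw m R f hf => by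
    obtain ⟨v₀, hv₀⟩ := exists_increasing r hl
    obtain ⟨w₀, hw₀⟩ := exists_increasing r (hp.nodup_iff.1 hl)
    have hv₁ := hv₀.sublist ((List.filter_sublist (p := p)).map v₀)
    have hw₁ := hw₀.sublist ((List.filter_sublist (p := p)).map w₀)
    rw [h.relMap_iff hv hv₁ R hf,
      h.relMap_iff hw hw₁ R fun i => (hp.filter p).mem_iff.1 (hf i)]
    exact hR v₀ w₀ hv₀ hw₀ m R f fun i => List.mem_of_mem_filter (hf i)⟩
  map := fun g hg ⟨hl, hp, hR⟩ => ⟨(List.nodup_map_iff_inj_on hl).2 hg, hp.map g,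
    fun v w hv hw m R f hf => by
      choose f' hf' hff' using fun i => List.mem_map.1 (hf i)
      obtain rfl : g ∘ f' = f := funext hff'
      exact hR (v ∘ g) (w ∘ g) (by simpa using hv) (by simpa using hw) m R f' hf'⟩

/-- An order chaining the structure that agrees with the given one along a sequence is
equivalent to it. -/
theorem TypeInvariant.orderEquiv [IsStrictTotalOrder M r] [IsStrictTotalOrder M s]
    (hr : TypeInvariant L r) (hs : TypeInvariant L s) {a : ℕ → M} (ha : Agree r s a) :
    OrderEquiv (arrangementRel L r) r s := by
  intro l l' hp hl hl'
  have hn := nodup_of_pairwise hl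
  refine ⟨hn, hp, fun v w hv hw m R f hf => ?_⟩
  have hf' : ∀ i, f i ∈ l' := fun i => hp.mem_iff.1 (hf i)
  obtain ⟨B, hB, -, hBr, hBs⟩ := ha.exists_block 0 l'.length
  obtain ⟨x, rfl, -⟩ := exists_relabel (hp.nodup_iff.1 hn) (nodup_of_pairwise hBr) hB.symm
  rw [hr.relMap_iff hv (w := id) (by simpa using hl) R hf, hr.relMap_iff hw hBr R hf',
    hs.relMap_iff hBs (w := id) (by simpa using hl') R hf']

theorem typeInvariant_of_orderEquiv [Infinite M] [IsStrictTotalOrder M r]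
    [IsStrictTotalOrder M s] (h : OrderEquiv (arrangementRel L r) r s) : TypeInvariant L s := by
  classical
  intro m R v w hvw
  have heq : ∀ i j, v i = v j → w i = w j := fun i j e => by
    have h1 : ¬ s (w i) (w j) := fun h => irrefl_of s _ (e ▸ (hvw i j).2 h)
    have h2 : ¬ s (w j) (w i) := fun h => irrefl_of s _ (e ▸ (hvw j i).2 h)
    exact ((trichotomous_of s (w i) (w j)).resolve_left h1).resolve_right h2
  obtain ⟨g, hg⟩ : ∃ g : M → M, ∀ i, g (v i) = w i := by
    refine ⟨fun x => if hx : ∃ i, v i = x then w hx.choose else x, fun i => ?_⟩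
    have hx : ∃ j, v j = v i := ⟨i, rfl⟩
    simp only [hx, dif_pos]
    exact heq _ _ hx.choose_spec
  obtain ⟨l', hl', hs'⟩ := exists_sorted_perm s (Finset.univ.image v).nodup_toList
  have hmem : ∀ x, x ∈ l' ↔ ∃ i, v i = x := fun x => by rw [← hl'.mem_iff]; simp
  have hg' : (l'.map g).Pairwise s := List.pairwise_map.2 (hs'.imp_of_mem fun {x y} hx hy hxy => by
    obtain ⟨i, rfl⟩ := (hmem x).1 hx
    obtain ⟨j, rfl⟩ := (hmem y).1 hy
    rw [hg, hg]
    exact (hvw i j).1 hxy)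
  obtain ⟨x, hx⟩ := exists_increasing r (nodup_of_pairwise hg')
  obtain ⟨k, hk, hkr⟩ := exists_sorted_perm r (nodup_of_pairwise hs')
  obtain ⟨k', hk', hkr'⟩ := exists_sorted_perm r (nodup_of_pairwise hg')
  have h1 := (h k l' hk.symm hkr hs').2.2 id (x ∘ g) (by simpa using hkr) (by simpa using hx)
    m R v fun i => hk.mem_iff.1 ((hmem _).2 ⟨i, rfl⟩)
  have h2 := (h k' (l'.map g) hk'.symm hkr' hg').2.2 id x (by simpa using hkr') hx
    m R w fun i => hk'.mem_iff.1 (List.mem_map.2 ⟨v i, (hmem _).2 ⟨i, rfl⟩, hg i⟩)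
  obtain rfl : g ∘ v = w := funext hg
  exact h1.trans h2.symm

theorem exists_agree [Infinite M] (r s : M → M → Prop) [IsStrictTotalOrder M r]
    [IsStrictTotalOrder M s] : ∃ a : ℕ → M, Agree r s a ∨ Agree r (swap s) a := by
  have hmono : ∀ (t : M → M → Prop) [IsStrictTotalOrder M t] (f : ℕ → M), Injective f →
      ∃ g : ℕ ↪o ℕ, (∀ m n, m < n → t (f (g m)) (f (g n))) ∨
        ∀ m n, m < n → t (f (g n)) (f (g m)) := fun t _ f hf => by
    obtain ⟨g, hg | hg⟩ := exists_increasing_or_nonincreasing_subseq t f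
    · exact ⟨g, .inl hg⟩
    · refine ⟨g, .inr fun m n hmn => ?_⟩
      rcases trichotomous_of t (f (g m)) (f (g n)) with h | h | h
      · exact absurd h (hg m n hmn)
      · exact absurd (g.injective (hf h)) hmn.ne
      · exact h
  obtain ⟨g, hg⟩ := hmono r (Infinite.natEmbedding M) (Infinite.natEmbedding M).injective
  obtain ⟨k, hk⟩ := hmono s (fun n => Infinite.natEmbedding M (g n))
    ((Infinite.natEmbedding M).injective.comp g.injective)
  refine ⟨fun n => Infinite.natEmbedding M (g (k n)), ?_⟩
  have hg' := hg.imp (fun h m n (hmn : m < n) => h (k m) (k n) (k.lt_iff_lt.2 hmn))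
    (fun h m n (hmn : m < n) => h (k m) (k n) (k.lt_iff_lt.2 hmn))
  rcases hg' with h1 | h1 <;> rcases hk with h2 | h2
  · exact .inl (.inl fun m n hmn => ⟨h1 m n hmn, h2 m n hmn⟩)
  · exact .inr (.inl fun m n hmn => ⟨h1 m n hmn, h2 m n hmn⟩)
  · exact .inr (.inr fun m n hmn => ⟨h1 m n hmn, h2 m n hmn⟩)
  · exact .inl (.inr fun m n hmn => ⟨h1 m n hmn, h2 m n hmn⟩)

theorem disjoint_initialBlock [Infinite M] [IsStrictTotalOrder M r] (p q : ℕ) :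
    Disjoint (initialBlock r p) (initialBlock (swap r) q) := by
  refine Set.disjoint_left.2 fun x hx hx' => ?_
  have h1 : {y | r y x}.Finite := Set.finite_of_encard_le_coe (le_of_lt hx)
  have h2 : {y | r x y}.Finite := Set.finite_of_encard_le_coe (le_of_lt hx')
  refine Set.infinite_univ (α := M) (((h1.union h2).union (Set.finite_singleton x)).subset ?_)
  intro y _
  rcases trichotomous_of r x y with h | h | h
  · exact .inl (.inr h)
  · exact .inr h.symm
  · exact .inl (.inl h)

/-- The orders chaining the structure are, up to reversal, those equivalent to a given one. -/
theorem typeInvariant_iff_orderEquiv [Infinite M] [IsStrictTotalOrder M r]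
    [IsStrictTotalOrder M s] (hr : TypeInvariant L r) {P : (M → M → Prop) → Prop}
    (hP : ∀ t : M → M → Prop, IsStrictTotalOrder M t → P t → OrderEquiv (arrangementRel L r) r t)
    (hP' : ∀ (t : M → M → Prop) (a : ℕ → M), IsStrictTotalOrder M t →
      OrderEquiv (arrangementRel L r) r t → Agree r t a → P t) :
    TypeInvariant L s ↔ P s ∨ P (swap s) := by
  have : IsStrictTotalOrder M (swap s) := inferInstance
  constructor
  · intro hs
    obtain ⟨a, ha | ha⟩ := exists_agree r s
    · exact .inl (hP' s a inferInstance (hr.orderEquiv hs ha) ha)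
    · exact .inr (hP' (swap s) a inferInstance (hr.orderEquiv hs.swap ha) ha)
  · rintro (h | h)
    · exact typeInvariant_of_orderEquiv (hP s inferInstance h)
    · exact (typeInvariant_of_orderEquiv (hP (swap s) inferInstance h)).swap

end Chains

section Main

variable {L : FirstOrder.Language.{u, v}} {M : Type w}

theorem isStrictTotalOrder_lt (lo : LinearOrder M) : IsStrictTotalOrder M lo.lt :=
  inferInstance

/-- The restriction of a strict total order to a subset, as a linear order. -/
@[reducible] noncomputable def restrictOrder (t : M → M → Prop) [IsStrictTotalOrder M t]
    (K : Set M) : LinearOrder K :=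
  letI := Classical.decRel t
  letI := linearOrderOfSTO t
  inferInstance

theorem tripleRel_iff_of_rel {lo : LinearOrder M} {K H : Set M} (hdisj : Disjoint K H)
    (hK : ∀ a b : M, lo.lt a b → b ∈ K → a ∈ K) (hH : ∀ a b : M, lo.lt a b → a ∈ H → b ∈ H)
    {t : M → M → Prop} [IsStrictTotalOrder M t]
    (ht : ∀ a b, lo.lt a b → b ∉ K → a ∉ H → t a b) (a b : M) :
    t a b ↔ tripleRel lo K H (restrictOrder t K).lt (restrictOrder t H).lt a b := by
  have hKH : ∀ x, x ∈ K → x ∉ H := fun _ hx => Set.disjoint_left.1 hdisj hx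
  have hlt : ∀ (S : Set M) (x y : S), (restrictOrder t S).lt x y ↔ t x y := fun S x y => Iff.rfl
  have has : t a b → ¬ t b a := asymm_of t
  have hirr : a = b → ¬ t a b := by rintro rfl; exact irrefl_of t a
  have htri : lo.lt a b ∨ a = b ∨ lo.lt b a := lt_trichotomy a b
  simp only [tripleRel, hlt, exists_prop]
  have hasymm : lo.lt a b → ¬ lo.lt b a := lt_asymm
  grind

variable [L.Structure M] [Infinite M]

theorem chains_of_isFull (lo : LinearOrder M) (hf : IsFull (arrangementRel L lo.lt))
    (lo' : LinearOrder M) : Chains L lo' := by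
  have := isStrictTotalOrder_lt lo
  have := isStrictTotalOrder_lt lo'
  exact (chains_iff_typeInvariant lo').2 <| typeInvariant_of_orderEquiv (r := lo.lt) (s := lo'.lt)
    fun _ _ hp hl _ => hf _ _ (nodup_of_pairwise hl) hp

theorem chains_iff_of_isCyclic {lo : LinearOrder M} (hlo : Chains L lo)
    (hc : IsCyclic (arrangementRel L lo.lt)) (hf : ¬ IsFull (arrangementRel L lo.lt))
    (lo' : LinearOrder M) : Chains L lo' ↔
      ∃ I : Set M, (∀ a b : M, lo.lt a b → b ∈ I → a ∈ I) ∧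
        ((∀ a b : M, lo'.lt a b ↔ cutRel lo I a b) ∨
         (∀ a b : M, lo'.lt a b ↔ cutRel lo I b a)) := by
  have := isStrictTotalOrder_lt lo
  have := isStrictTotalOrder_lt lo'
  rw [chains_iff_typeInvariant] at hlo ⊢
  have hE := isPatternEquiv_arrangementRel hlo
  rw [typeInvariant_iff_orderEquiv (s := lo'.lt) hlo (P := fun t => ∃ I : Set M,
    (∀ a b : M, lo.lt a b → b ∈ I → a ∈ I) ∧ ∀ a b : M, t a b ↔ cutRel lo I a b)]
  · constructor
    · rintro (⟨I, hI, h⟩ | ⟨I, hI, h⟩)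
      · exact ⟨I, hI, .inl h⟩
      · exact ⟨I, hI, .inr fun a b => h b a⟩
    · rintro ⟨I, hI, h | h⟩
      · exact .inl ⟨I, hI, h⟩
      · exact .inr ⟨I, hI, fun a b => h b a⟩
  · rintro t - ⟨I, hI, h⟩
    obtain rfl : t = cutOf lo.lt I := funext fun a => funext fun b => propext (h a b)
    exact orderEquiv_cutOf hE hc hI
  · intro t a _ ht ha
    exact exists_cutOf hE hc hf ht ha

theorem exists_chains_iff_of_not_isCyclic {lo : LinearOrder M} (hlo : Chains L lo)
    (hc : ¬ IsCyclic (arrangementRel L lo.lt)) (hf : ¬ IsFull (arrangementRel L lo.lt)) :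
    ∃ K H : Set M, K.Finite ∧ H.Finite ∧ Disjoint K H ∧
      (∀ a b : M, lo.lt a b → b ∈ K → a ∈ K) ∧
      (∀ a b : M, lo.lt a b → a ∈ H → b ∈ H) ∧
      ∀ lo' : LinearOrder M, Chains L lo' ↔
        ∃ (loK : LinearOrder K) (loH : LinearOrder H),
          ((∀ a b : M, lo'.lt a b ↔ tripleRel lo K H loK.lt loH.lt a b) ∨
           (∀ a b : M, lo'.lt a b ↔ tripleRel lo K H loK.lt loH.lt b a)) := by
  classical
  have hlo' := (chains_iff_typeInvariant lo).1 hlo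
  have hE := isPatternEquiv_arrangementRel hlo'
  have hp : ∃ p, ¬ SwapAt (arrangementRel L lo.lt) p := by
    by_contra! h
    exact hf (hE.isFull_of_swapAt h)
  have hq : ∃ q, ¬ SwapAt (revRel (arrangementRel L lo.lt)) q := by
    by_contra! h
    exact hf (hE.rev.isFull_of_swapAt h).of_rev
  obtain ⟨p, hp, hp'⟩ : ∃ p, ¬ SwapAt (arrangementRel L lo.lt) p ∧
      ∀ i, i + 1 < p + 1 → SwapAt (arrangementRel L lo.lt) i :=
    ⟨Nat.find hp, Nat.find_spec hp, fun i hi => not_not.1 (Nat.find_min hp (by omega))⟩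
  obtain ⟨q, hq, hq'⟩ : ∃ q, ¬ SwapAt (revRel (arrangementRel L lo.lt)) q ∧
      ∀ i, i + 1 < q + 1 → SwapAt (revRel (arrangementRel L lo.lt)) i :=
    ⟨Nat.find hq, Nat.find_spec hq, fun i hi => not_not.1 (Nat.find_min hq (by omega))⟩
  have hdisj := disjoint_initialBlock (r := lo.lt) (p + 1) (q + 1)
  have hK : ∀ a b : M, lo.lt a b → b ∈ initialBlock lo.lt (p + 1) →
      a ∈ initialBlock lo.lt (p + 1) := fun a b => mem_initialBlock_of_rel
  have hH : ∀ a b : M, lo.lt a b → a ∈ initialBlock (swap lo.lt) (q + 1) →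
      b ∈ initialBlock (swap lo.lt) (q + 1) :=
    fun a b hab => mem_initialBlock_of_rel (r := swap lo.lt) hab
  refine ⟨initialBlock lo.lt (p + 1), initialBlock (swap lo.lt) (q + 1), finite_initialBlock,
    finite_initialBlock, hdisj, hK, hH, fun lo' => ?_⟩
  have := isStrictTotalOrder_lt lo
  have := isStrictTotalOrder_lt lo'
  rw [chains_iff_typeInvariant, typeInvariant_iff_orderEquiv (s := lo'.lt) hlo' (P := fun t =>
    ∃ (loK : LinearOrder (initialBlock lo.lt (p + 1)))
      (loH : LinearOrder (initialBlock (swap lo.lt) (q + 1))),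
        ∀ a b : M, t a b ↔ tripleRel lo _ _ loK.lt loH.lt a b)]
  · constructor
    · rintro (⟨loK, loH, h⟩ | ⟨loK, loH, h⟩)
      · exact ⟨loK, loH, .inl h⟩
      · exact ⟨loK, loH, .inr fun a b => h b a⟩
    · rintro ⟨loK, loH, h | h⟩
      · exact .inl ⟨loK, loH, h⟩
      · exact .inr ⟨loK, loH, fun a b => h b a⟩
  · rintro t _ ⟨loK, loH, h⟩
    refine orderEquiv_of_rel_of_rel hE hp' hq' hdisj fun x y hxy hxK hxH => (h x y).2 ?_
    have h1 := hK x y hxy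
    have h2 := hH x y hxy
    have h3 : y ∈ initialBlock lo.lt (p + 1) → y ∉ initialBlock (swap lo.lt) (q + 1) :=
      fun hy => Set.disjoint_left.1 hdisj hy
    unfold tripleRel
    tauto
  · intro t a _ ht ha
    exact ⟨restrictOrder t _, restrictOrder t _, tripleRel_iff_of_rel hdisj hK hH
      fun x y hxy hy hx => ha.rel_of_rel hE hc hp hq ht hxy hy hx⟩

end Main
end GibsonPouzetWoodrow

/-- **Gibson–Pouzet–Woodrow theorem.** Let `M` be an infinite monomorphic structure in a
relational language and let `lo` be a linear order chaining `M`. Then (i) every linear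
order on the domain chains `M`, or (ii) the linear orders chaining `M` are exactly the
orders `F + I` (and their reverses) obtained from decompositions of `lo` into an initial
segment `I` and the complementary final segment `F`, or (iii) there are finite sets `K`, `H`
such that `K` is an initial and `H` a final segment of `lo` and the orders chaining `M` are
exactly the concatenations `⊲_K + (M \ (K ∪ H), lo) + ⊲_H` (and their reverses), where
`⊲_K`, `⊲_H` range over all linear orders on `K`, `H` respectively. -/
theorem gibson_pouzet_woodrow
    (L : FirstOrder.Language.{u, v}) [L.IsRelational] (M : Type w) [L.Structure M]
    [Infinite M] (hmono : IsMonomorphic L M)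
    (lo : LinearOrder M) (hchain : Chains L lo) :
    (∀ lo' : LinearOrder M, Chains L lo') ∨
    (∀ lo' : LinearOrder M, Chains L lo' ↔
      ∃ I : Set M, (∀ a b : M, lo.lt a b → b ∈ I → a ∈ I) ∧
        ((∀ a b : M, lo'.lt a b ↔ cutRel lo I a b) ∨
         (∀ a b : M, lo'.lt a b ↔ cutRel lo I b a))) ∨
    (∃ K H : Set M, K.Finite ∧ H.Finite ∧ Disjoint K H ∧
      (∀ a b : M, lo.lt a b → b ∈ K → a ∈ K) ∧
      (∀ a b : M, lo.lt a b → a ∈ H → b ∈ H) ∧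
      ∀ lo' : LinearOrder M, Chains L lo' ↔
        ∃ (loK : LinearOrder K) (loH : LinearOrder H),
          ((∀ a b : M, lo'.lt a b ↔ tripleRel lo K H loK.lt loH.lt a b) ∨
           (∀ a b : M, lo'.lt a b ↔ tripleRel lo K H loK.lt loH.lt b a))) := by
  by_cases hf : GibsonPouzetWoodrow.IsFull (GibsonPouzetWoodrow.arrangementRel L lo.lt)
  · exact .inl (GibsonPouzetWoodrow.chains_of_isFull lo hf)
  by_cases hc : GibsonPouzetWoodrow.IsCyclic (GibsonPouzetWoodrow.arrangementRel L lo.lt)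
  · exact .inr (.inl (GibsonPouzetWoodrow.chains_iff_of_isCyclic hchain hc hf))
  · exact .inr (.inr (GibsonPouzetWoodrow.exists_chains_iff_of_not_isCyclic hchain hc hf))
end

section
/- Let Y be a monomorphic structure in a relational first-order language L and let Z be an L-structure elementarily equivalent to Y. Then Z is monomorphic and Z has the same age as Y, i.e., a finite L-structure embeds into Z if and only if it embeds into Y. -/
open FirstOrder Cardinal

universe u v w w' x

open FirstOrder.Language FirstOrder.Language.Structure

/-- Tuples in two structures satisfy the same relations. -/
def SameRelations (L : FirstOrder.Language.{u, v}) {α M N : Type*} [L.Structure M]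
    [L.Structure N] (x : α → M) (y : α → N) : Prop :=
  ∀ (k : ℕ) (R : L.Relations k) (i : Fin k → α), RelMap R (x ∘ i) ↔ RelMap R (y ∘ i)

namespace SameRelations

variable {L : FirstOrder.Language.{u, v}} {α β M N P : Type*} [L.Structure M] [L.Structure N]
  [L.Structure P] {x : α → M} {y : α → N} {z : α → P}

theorem symm (h : SameRelations L x y) : SameRelations L y x :=
  fun k R i => (h k R i).symm

theorem trans (h : SameRelations L x y) (h' : SameRelations L y z) : SameRelations L x z :=
  fun k R i => (h k R i).trans (h' k R i)

theorem comp (h : SameRelations L x y) (f : β → α) : SameRelations L (x ∘ f) (y ∘ f) :=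
  fun k R i => h k R (f ∘ i)

end SameRelations

/-- In elementarily equivalent structures, any finite tuple of one can be matched by a tuple of
the other with respect to finitely many formulas. -/
theorem FirstOrder.Language.ElementarilyEquivalent.exists_realize_iff
    {L : FirstOrder.Language.{u, v}} {M N : Type*} [L.Structure M] [L.Structure N]
    (h : L.ElementarilyEquivalent M N) {α ι : Type*} [Finite α] [Finite ι]
    (φ : ι → L.Formula α) (x : α → M) :
    ∃ y : α → N, ∀ i, (φ i).Realize x ↔ (φ i).Realize y := by
  classical
  let ψ : L.Formula α := .iInf fun i => if (φ i).Realize x then φ i else (φ i).not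
  let χ : L.Sentence := (ψ.relabel (Sum.inr : α → Empty ⊕ α)).iExs α
  have hM : M ⊨ χ := by
    simp only [χ, Sentence.Realize, Formula.realize_iExs, Formula.realize_relabel,
      Sum.elim_comp_inr]
    refine ⟨x, Formula.realize_iInf.2 fun i => ?_⟩
    split_ifs with hi <;> simpa using hi
  have hN : N ⊨ χ := (h.realize_sentence χ).1 hM
  simp only [χ, Sentence.Realize, Formula.realize_iExs, Formula.realize_relabel,
    Sum.elim_comp_inr] at hN
  obtain ⟨y, hy⟩ := hN
  refine ⟨y, fun i => ?_⟩
  have hi := Formula.realize_iInf.1 hy i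
  split_ifs at hi with hx
  · exact iff_of_true hx hi
  · exact iff_of_false hx hi

/-- A finite injective tuple can be matched, with respect to equality and finitely many atomic
formulas, in any elementarily equivalent structure. -/
theorem FirstOrder.Language.ElementarilyEquivalent.exists_injective_relMap_iff
    {L : FirstOrder.Language.{u, v}} {M N : Type*} [L.Structure M] [L.Structure N]
    (h : L.ElementarilyEquivalent M N) {α ι : Type*} [Finite α] [Finite ι]
    {k : ι → ℕ} (R : ∀ i, L.Relations (k i)) (t : ∀ i, Fin (k i) → α)
    {x : α → M} (hx : x.Injective) :
    ∃ y : α → N, y.Injective ∧ ∀ i, RelMap (R i) (x ∘ t i) ↔ RelMap (R i) (y ∘ t i) := by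
  obtain ⟨y, hy⟩ := h.exists_realize_iff
    (Sum.elim (fun p : α × α => (Term.var p.1).equal (Term.var p.2))
      (fun i => (R i).formula fun j => Term.var (t i j))) x
  refine ⟨y, fun a b hab => hx ?_, fun i => ?_⟩
  · simpa [hab] using hy (.inl (a, b))
  · simpa [Formula.realize_rel, Function.comp_def] using hy (.inr i)

/-- Finite injective tuples of a monomorphic structure satisfy the same relations up to a
permutation of the indices. -/
theorem IsMonomorphic.exists_perm_sameRelations {L : FirstOrder.Language.{u, v}}
    [L.IsRelational] {M : Type*} [L.Structure M] (h : IsMonomorphic L M) {α : Type*} [Finite α]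
    {x y : α → M} (hx : x.Injective) (hy : y.Injective) :
    ∃ σ : Equiv.Perm α, SameRelations L x (y ∘ σ) := by
  obtain ⟨f⟩ := h (Set.range x) (Set.range y) (Set.finite_range x) (Set.finite_range y) (by
    rw [← Nat.card_coe_set_eq, ← Nat.card_coe_set_eq, Nat.card_range_of_injective hx,
      Nat.card_range_of_injective hy])
  let _ := inducedStructure L (Set.range x)
  let _ := inducedStructure L (Set.range y)
  let ex := Equiv.ofInjective x hx
  let ey := Equiv.ofInjective y hy
  refine ⟨(ex.trans f.toEquiv).trans ey.symm, fun k R i => ?_⟩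
  have hval (a : α) : y (ey.symm (f.toEquiv (ex a))) = f.toEquiv (ex a) :=
    Equiv.apply_ofInjective_symm hy _
  have hrel : RelMap R (fun j => (f.toEquiv (ex (i j)) : M)) ↔ RelMap R (x ∘ i) :=
    f.map_rel' R (ex ∘ i)
  rw [← hrel]
  simp only [Function.comp_def, Equiv.trans_apply, hval]

/-- Finite injective tuples of a monomorphic structure and of an elementarily equivalent one
satisfy the same relations up to a permutation of the indices. -/
theorem IsMonomorphic.exists_perm_sameRelations_of_elementarilyEquivalent
    {L : FirstOrder.Language.{u, v}} [L.IsRelational] {M N : Type*} [L.Structure M]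
    [L.Structure N] (h : IsMonomorphic L M) (heq : L.ElementarilyEquivalent M N)
    {α : Type*} [Finite α] {x : α → M} {y : α → N} (hx : x.Injective) (hy : y.Injective) :
    ∃ σ : Equiv.Perm α, SameRelations L y (x ∘ σ) := by
  by_contra! hcon
  simp only [SameRelations, not_forall] at hcon
  choose k R t hR using hcon
  obtain ⟨y', hy', hyy'⟩ := heq.symm.exists_injective_relMap_iff R t hy
  obtain ⟨σ, hσ⟩ := h.exists_perm_sameRelations hy' hx
  exact hR σ ((hyy' σ).trans (hσ _ _ _))

/-- A finite injective tuple can be transferred to an elementarily equivalent structure. -/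
theorem FirstOrder.Language.ElementarilyEquivalent.exists_injective
    {L : FirstOrder.Language.{u, v}} {M N : Type*} [L.Structure M] [L.Structure N]
    (h : L.ElementarilyEquivalent M N) {α : Type*} [Finite α] {x : α → M} (hx : x.Injective) :
    ∃ y : α → N, y.Injective :=
  let ⟨y, hy, _⟩ := h.exists_injective_relMap_iff (ι := Empty) (k := Empty.elim)
    (fun i => i.elim) (fun i => i.elim) hx
  ⟨y, hy⟩

/-- An injective tuple satisfying the same relations as the identity is an embedding. -/
def SameRelations.toEmbedding {L : FirstOrder.Language.{u, v}} [L.IsRelational] {A M : Type*}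
    [L.Structure A] [L.Structure M] {x : A → M} (hx : x.Injective)
    (h : SameRelations L x (id : A → A)) : A ↪[L] M where
  toFun := x
  inj' := hx
  map_fun' f := isEmptyElim f
  map_rel' R i := h _ R i

/-- An embedding satisfies the same relations as the identity. -/
theorem FirstOrder.Language.Embedding.sameRelations {L : FirstOrder.Language.{u, v}}
    {A M : Type*} [L.Structure A] [L.Structure M] (f : A ↪[L] M) :
    SameRelations L f (id : A → A) :=
  fun _ R i => f.map_rel R i

/-- If `Y` is a monomorphic structure in a relational language and `Z` is elementarily
equivalent to `Y`, then `Z` is monomorphic and has the same age as `Y`: a finite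
`L`-structure embeds into `Z` iff it embeds into `Y`. -/
theorem elementarily_equivalent_to_monomorphic
    (L : FirstOrder.Language.{u, v}) [L.IsRelational]
    (Y : Type w) (Z : Type w') [L.Structure Y] [L.Structure Z]
    (hmono : IsMonomorphic L Y)
    (heq : FirstOrder.Language.ElementarilyEquivalent L Y Z) :
    IsMonomorphic L Z ∧
      ∀ (A : Type x) [L.Structure A], Finite A →
        (Nonempty (FirstOrder.Language.Embedding L A Z) ↔
          Nonempty (FirstOrder.Language.Embedding L A Y)) := by
  refine ⟨fun s t hs ht hst => ?_, fun A _ _ => ⟨fun ⟨f⟩ => ?_, fun ⟨f⟩ => ?_⟩⟩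
  · have := hs.to_subtype
    have := ht.to_subtype
    obtain ⟨e⟩ : Nonempty (s ≃ t) := Finite.card_eq.1 hst
    have hx : Function.Injective (Subtype.val : s → Z) := Subtype.val_injective
    have hy : Function.Injective ((Subtype.val : t → Z) ∘ e) :=
      Subtype.val_injective.comp e.injective
    obtain ⟨a, ha⟩ := heq.symm.exists_injective hx
    obtain ⟨σ, hσ⟩ := hmono.exists_perm_sameRelations_of_elementarilyEquivalent heq ha hx
    obtain ⟨τ, hτ⟩ := hmono.exists_perm_sameRelations_of_elementarilyEquivalent heq ha hy
    let _ := inducedStructure L s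
    let _ := inducedStructure L t
    have key : SameRelations L (((Subtype.val : t → Z) ∘ e) ∘ (σ.trans τ.symm))
        (Subtype.val : s → Z) := by
      refine (hτ.comp _).trans ?_
      have : (a ∘ τ) ∘ (σ.trans τ.symm) = a ∘ σ := by ext; simp
      rw [this]
      exact hσ.symm
    exact ⟨{ toEquiv := (σ.trans τ.symm).trans e
             map_fun' := fun f => isEmptyElim f
             map_rel' := fun R i => key _ R i }⟩
  · obtain ⟨y, hy⟩ := heq.symm.exists_injective f.injective
    obtain ⟨σ, hσ⟩ :=
      hmono.exists_perm_sameRelations_of_elementarilyEquivalent heq hy f.injective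
    exact ⟨(hσ.symm.trans f.sameRelations).toEmbedding (hy.comp σ.injective)⟩
  · obtain ⟨z, hz⟩ := heq.exists_injective f.injective
    obtain ⟨σ, hσ⟩ :=
      hmono.exists_perm_sameRelations_of_elementarilyEquivalent heq f.injective hz
    have h := hσ.comp σ.symm
    rw [Function.comp_assoc, Equiv.self_comp_symm, Function.comp_id] at h
    exact ⟨(h.trans f.sameRelations).toEmbedding (hz.comp σ.symm.injective)⟩
end

section
/- Let L = ⟨R_i : i ∈ I⟩ be a relational first-order language with uncountably many relation symbols and let T be a complete monomorphic L-theory having infinite models. Then T has a model with countable domain, and there exist a countable subset J ⊆ I and a complete monomorphic theory T_J in the reduct language L_J = ⟨R_i : i ∈ J⟩ such that the number of isomorphism classes of models of T with domain ℕ equals the number of isomorphism classes of models of T_J with domain ℕ. -/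
open FirstOrder Cardinal

universe u v w w' x

/-- The isomorphism classes of models of `T` with domain `ℕ`. -/
def CountableModelClasses (L : FirstOrder.Language.{u, v}) (T : L.Theory) : Type (max u v) :=
  Quot (fun S₁ S₂ : {S : L.Structure ℕ // @FirstOrder.Language.Theory.Model L ℕ S T} =>
    Nonempty (@FirstOrder.Language.Equiv L ℕ ℕ S₁.1 S₂.1))

/-- `I(T,ω)`: the number of isomorphism classes of models of `T` with domain `ℕ`
(equivalently, of countably infinite models of `T`, when `T` has only infinite models). -/
noncomputable def numCountableModels (L : FirstOrder.Language.{u, v}) (T : L.Theory) :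
    Cardinal.{max u v} :=
  Cardinal.mk (CountableModelClasses L T)

/-- A theory is monomorphic if every model of it is a monomorphic structure. -/
def IsMonomorphicTheory (L : FirstOrder.Language.{u, v}) [L.IsRelational] (T : L.Theory) : Prop :=
  ∀ (M : Type w) [L.Structure M], M ⊨ T → IsMonomorphic L M

/-- The sublanguage of a relational language `L` consisting of the relation symbols in a
set `J` of relation symbols of `L`. -/
def sublang (L : FirstOrder.Language.{u, v}) (J : Set (Σ n, L.Relations n)) :
    FirstOrder.Language :=
  ⟨fun _ => Empty, fun n => {R : L.Relations n // Sigma.mk n R ∈ J}⟩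

instance (L : FirstOrder.Language.{u, v}) (J : Set (Σ n, L.Relations n)) :
    (sublang L J).IsRelational :=
  fun _ => inferInstanceAs (IsEmpty Empty)

/-- The inclusion of the sublanguage determined by `J` into `L`. -/
def sublangHom (L : FirstOrder.Language.{u, v}) (J : Set (Σ n, L.Relations n)) :
    FirstOrder.Language.LHom (sublang L J) L where
  onFunction := fun {n} f => isEmptyElim f
  onRelation := fun {n} R => R.1

/-- The reduct of an `L`-structure to the sublanguage determined by a set `J` of relation
symbols of `L`. -/
def reductStructure (L : FirstOrder.Language.{u, v}) {M : Type w} [L.Structure M]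
    (J : Set (Σ n, L.Relations n)) : (sublang L J).Structure M where
  funMap f := isEmptyElim f
  RelMap R v := FirstOrder.Language.Structure.RelMap R.1 v

open FirstOrder.Language FirstOrder.Language.Structure

/-- In an infinite monomorphic structure two relations of arity `n` coincide as soon as they
coincide on tuples from a single `n`-element set. -/
theorem IsMonomorphic.relMap_iff_of_agree {L : FirstOrder.Language.{u, v}} [L.IsRelational]
    {M : Type w} [L.Structure M] [Infinite M] (hM : IsMonomorphic L M) {n : ℕ}
    {F : Finset M} (hF : F.card = n) {R R' : L.Relations n}
    (h : ∀ v : Fin n → F, RelMap R (fun i => (v i : M)) ↔ RelMap R' (fun i => (v i : M)))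
    (x : Fin n → M) : RelMap R x ↔ RelMap R' x := by
  classical
  obtain ⟨G, hxG, hG⟩ := Infinite.exists_superset_card_eq (Finset.univ.image x) n
    (Finset.card_image_le.trans (by simp))
  have hx : ∀ i, x i ∈ (G : Set M) := fun i => hxG (by simp)
  obtain ⟨e⟩ := hM (F : Set M) (G : Set M) F.finite_toSet G.finite_toSet
    (by simp [hF, hG])
  let := inducedStructure L (F : Set M)
  let := inducedStructure L (G : Set M)
  let y : Fin n → (F : Set M) := fun i => e.toEquiv.symm ⟨x i, hx i⟩
  have hy : e.toEquiv ∘ y = fun i => ⟨x i, hx i⟩ := by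
    funext i
    simp [y]
  have key : ∀ Q : L.Relations n, RelMap Q x ↔ RelMap Q (fun i => (y i : M)) := by
    intro Q
    have hQ : RelMap Q (e.toEquiv ∘ y) ↔ RelMap Q y := e.map_rel' Q y
    rw [hy] at hQ
    exact hQ
  exact (key R).trans ((h y).trans (key R').symm)

/-- In an infinite monomorphic structure there are only finitely many relations of each arity;
representatives can be chosen by an idempotent map on relation symbols. -/
theorem IsMonomorphic.exists_representatives {L : FirstOrder.Language.{u, v}} [L.IsRelational]
    {M : Type w} [L.Structure M] [Infinite M] (hM : IsMonomorphic L M) :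
    ∃ rep : ∀ n, L.Relations n → L.Relations n,
      (∀ n R, rep n (rep n R) = rep n R) ∧ (∀ n, (Set.range (rep n)).Finite) ∧
        ∀ n R (x : Fin n → M), RelMap (rep n R) x ↔ RelMap R x := by
  choose F hF using fun n => Infinite.exists_subset_card_eq M n
  let trace : ∀ n, L.Relations n → Set (Fin n → F n) :=
    fun n R => {v | RelMap R (fun i => (v i : M))}
  refine ⟨fun n R => Set.rangeSplitting (trace n) (Set.rangeFactorization (trace n) R),
    fun n R => ?_, fun n => ?_, fun n R x => ?_⟩
  · simp only [Set.leftInverse_rangeSplitting (trace n) _]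
  · exact (Set.finite_range (Set.rangeSplitting (trace n))).subset
      (Set.range_subset_iff.2 fun R => Set.mem_range_self _)
  · exact hM.relMap_iff_of_agree (hF n) (fun v => Set.ext_iff.1
      (Set.apply_rangeSplitting (trace n) (Set.rangeFactorization (trace n) R)) v) x

/-- The set of all values of a map on relation symbols. -/
def representatives {L : FirstOrder.Language.{u, v}}
    (rep : ∀ n, L.Relations n → L.Relations n) : Set (Σ n, L.Relations n) :=
  Set.range fun p : Σ n, L.Relations n => ⟨p.1, rep p.1 p.2⟩

theorem representatives_countable {L : FirstOrder.Language.{u, v}}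
    {rep : ∀ n, L.Relations n → L.Relations n} (hfin : ∀ n, (Set.range (rep n)).Finite) :
    (representatives rep).Countable := by
  refine (Set.countable_iUnion fun n =>
    ((hfin n).image (Sigma.mk (β := L.Relations) n)).countable).mono ?_
  rintro _ ⟨⟨n, R⟩, rfl⟩
  exact Set.mem_iUnion.2 ⟨n, Set.mem_image_of_mem _ ⟨R, rfl⟩⟩

/-- The language map sending each relation symbol to its representative. -/
def collapseHom (L : FirstOrder.Language.{u, v}) [L.IsRelational]
    (rep : ∀ n, L.Relations n → L.Relations n) :
    FirstOrder.Language.LHom L (sublang L (representatives rep)) where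
  onFunction := fun {_} f => isEmptyElim f
  onRelation := fun {n} R => ⟨rep n R, ⟨n, R⟩, rfl⟩

theorem collapseHom_onRelation_val {L : FirstOrder.Language.{u, v}} [L.IsRelational]
    {rep : ∀ n, L.Relations n → L.Relations n} (hidem : ∀ n R, rep n (rep n R) = rep n R)
    {n : ℕ} (R : (sublang L (representatives rep)).Relations n) :
    (collapseHom L rep).onRelation R.1 = R := by
  obtain ⟨R, ⟨m, Q⟩, hQ⟩ := R
  obtain ⟨rfl, hQ⟩ := Sigma.mk.inj_iff.1 hQ
  obtain rfl := eq_of_heq hQ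
  exact Subtype.ext (hidem _ Q)

theorem sublangHom_reduct_collapseHom_reduct {L : FirstOrder.Language.{u, v}} [L.IsRelational]
    {rep : ∀ n, L.Relations n → L.Relations n} (hidem : ∀ n R, rep n (rep n R) = rep n R)
    {M : Type w} (S : (sublang L (representatives rep)).Structure M) :
    @LHom.reduct _ _ (sublangHom L (representatives rep)) M ((collapseHom L rep).reduct M) = S := by
  refine Structure.ext ?_ ?_
  · funext n f
    exact isEmptyElim f
  · funext n R x
    exact congrArg (fun Q => RelMap Q x) (collapseHom_onRelation_val hidem R)

theorem collapseHom_reduct_sublangHom_reduct {L : FirstOrder.Language.{u, v}} [L.IsRelational]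
    {rep : ∀ n, L.Relations n → L.Relations n} {M : Type w} (S : L.Structure M)
    (hrep : ∀ n R (x : Fin n → M), RelMap (rep n R) x ↔ RelMap R x) :
    @LHom.reduct _ _ (collapseHom L rep) M ((sublangHom L (representatives rep)).reduct M) = S := by
  refine Structure.ext ?_ ?_
  · funext n f
    exact isEmptyElim f
  · funext n R x
    exact propext (hrep n R x)

/-- An isomorphism of structures is an isomorphism of their reducts. -/
theorem nonempty_equiv_reduct {L : FirstOrder.Language.{u, v}} {L' : FirstOrder.Language.{w, w'}}
    (φ : L →ᴸ L') {M N : Type x} (S₁ : L'.Structure M) (S₂ : L'.Structure N)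
    (h : Nonempty (M ≃[L'] N)) :
    Nonempty (@FirstOrder.Language.Equiv L M N (φ.reduct M) (φ.reduct N)) := by
  let := φ.reduct M
  let := φ.reduct N
  exact h.map fun e => ⟨e.toEquiv, fun f y => e.map_fun' (φ.onFunction f) y,
    fun R y => e.map_rel' (φ.onRelation R) y⟩

theorem IsMonomorphic.sublangHom_reduct {L : FirstOrder.Language.{u, v}} [L.IsRelational]
    {M : Type w} [L.Structure M] (hM : IsMonomorphic L M) (J : Set (Σ n, L.Relations n)) :
    @IsMonomorphic (sublang L J) _ M ((sublangHom L J).reduct M) := by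
  intro s t hs ht hst
  let := inducedStructure L s
  let := inducedStructure L t
  obtain ⟨e⟩ := hM s t hs ht hst
  exact ⟨@FirstOrder.Language.Equiv.mk _ _ _ (_) (_) e.toEquiv (fun f => isEmptyElim f)
    (fun R y => e.map_rel' R.1 y)⟩

/-- The sentence stating that two relation symbols are interpreted by the same relation. -/
def relIffSentence {L : FirstOrder.Language.{u, v}} {n : ℕ} (R R' : L.Relations n) : L.Sentence :=
  ((R.boundedFormula fun i => Term.var (Sum.inr i)).iff
    (R'.boundedFormula fun i => Term.var (Sum.inr i)) : L.BoundedFormula Empty n).alls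

theorem realize_relIffSentence {L : FirstOrder.Language.{u, v}} {n : ℕ} (R R' : L.Relations n)
    (M : Type w) [L.Structure M] :
    M ⊨ relIffSentence R R' ↔ ∀ y : Fin n → M, RelMap R y ↔ RelMap R' y := by
  simp only [relIffSentence, Sentence.Realize, BoundedFormula.realize_alls,
    BoundedFormula.realize_iff, BoundedFormula.realize_rel, Term.realize_var, Sum.elim_inr]

/-- The expansion of a structure elementarily equivalent to the reduct of a model of `T` is
a model of `T`. -/
theorem model_collapseHom_reduct {L : FirstOrder.Language.{u, v}} [L.IsRelational] {T : L.Theory}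
    {rep : ∀ n, L.Relations n → L.Relations n} {M : Type w} [L.Structure M] (hM : M ⊨ T)
    (hrep : ∀ n R (y : Fin n → M), RelMap (rep n R) y ↔ RelMap R y) {N : Type w'}
    [(sublang L (representatives rep)).Structure N]
    (hN : N ⊨ @completeTheory (sublang L (representatives rep)) M
      ((sublangHom L (representatives rep)).reduct M)) :
    @Theory.Model L N ((collapseHom L rep).reduct N) T := by
  let := (sublangHom L (representatives rep)).reduct M
  let := (collapseHom L rep).reduct N
  have : (collapseHom L rep).IsExpansionOn M :=
    ⟨fun f => isEmptyElim f, fun {n} R y => propext (hrep n R y)⟩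
  rw [← (collapseHom L rep).onTheory_model]
  exact hN.mono (Theory.model_iff_subset_completeTheory.1
    (((collapseHom L rep).onTheory_model T).2 hM))

/-- Reducts of models of a complete theory are elementarily equivalent. -/
theorem model_completeTheory_sublangHom_reduct {L : FirstOrder.Language.{u, v}} {T : L.Theory}
    (hT : T.IsComplete) (J : Set (Σ n, L.Relations n)) {M : Type w} {N : Type w'}
    [L.Structure M] [L.Structure N] [Nonempty M] [Nonempty N] (hM : M ⊨ T) (hN : N ⊨ T) :
    @Theory.Model (sublang L J) N ((sublangHom L J).reduct N)
      (@completeTheory (sublang L J) M ((sublangHom L J).reduct M)) := by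
  let := (sublangHom L J).reduct M
  let := (sublangHom L J).reduct N
  refine ⟨fun σ hσ => ?_⟩
  rw [← (sublangHom L J).realize_onSentence N, hT.realize_sentence_iff,
    ← hT.realize_sentence_iff _ M, LHom.realize_onSentence]
  exact hσ

theorem card_sublang_le {L : FirstOrder.Language.{u, v}} {J : Set (Σ n, L.Relations n)}
    (hJ : J.Countable) : (sublang L J).card ≤ ℵ₀ := by
  have : Countable J := hJ
  have : Countable (Σ n, (sublang L J).Relations n) :=
    Function.Injective.countable (β := J) (f := fun R => ⟨⟨R.1, R.2.1⟩, R.2.2⟩) <| by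
      rintro ⟨n, R, hR⟩ ⟨m, Q, hQ⟩ h
      cases h
      rfl
  have : Countable (Σ n, (sublang L J).Functions n) :=
    Function.Injective.countable (β := ℕ) (f := fun f => isEmptyElim f.2) fun f => isEmptyElim f.2
  exact Cardinal.mk_le_aleph0_iff.2 (inferInstanceAs (Countable (_ ⊕ _)))

theorem exists_countable_model_completeTheory (L : FirstOrder.Language.{u, v})
    (hL : L.card ≤ ℵ₀) (M : Type w) [L.Structure M] [Infinite M] :
    ∃ _ : L.Structure ℕ, ℕ ⊨ L.completeTheory M := by
  obtain ⟨S, -, hS⟩ := exists_elementarySubstructure_card_eq L (∅ : Set M) aleph0.{0} le_rfl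
    (by simp) (by simpa using hL) (by simp)
  obtain ⟨e⟩ : Nonempty (S ≃ ℕ) := by
    rw [← Cardinal.lift_mk_eq']
    simpa using hS
  let : L.Structure ℕ := e.inducedStructure
  have hSM : S ⊨ L.completeTheory M := S.theory_model
  exact ⟨inferInstance, StrongHomClass.theory_model (e.inducedStructureEquiv (L := L))⟩

/-- If `L` is a relational language with uncountably many relation symbols and `T` is a
complete monomorphic `L`-theory having infinite models, then `T` has a model with domain
`ℕ`, and there are a countable set `J` of relation symbols and a complete monomorphic
theory `T_J` in the sublanguage `L_J` such that the number of isomorphism classes of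
models of `T` with domain `ℕ` equals that of models of `T_J` with domain `ℕ`. -/
theorem reduction_to_countable_language
    (L : FirstOrder.Language.{u, v}) [L.IsRelational]
    (huncount : ¬ Countable (Σ n, L.Relations n))
    (T : L.Theory) (hcomplete : T.IsComplete)
    (hmono : IsMonomorphicTheory.{u, v, w} L T)
    (hinf : ∃ (M : Type w) (_ : L.Structure M), Infinite M ∧ M ⊨ T) :
    (∃ (M : Type) (_ : L.Structure M), Countable M ∧ M ⊨ T) ∧
    ∃ J : Set (Σ n, L.Relations n), J.Countable ∧
      ∃ TJ : (sublang L J).Theory, TJ.IsComplete ∧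
        IsMonomorphicTheory.{0, v, w} (sublang L J) TJ ∧
        Cardinal.lift.{u} (numCountableModels (sublang L J) TJ) =
          numCountableModels L T := by
  obtain ⟨M, _, _, hMT⟩ := hinf
  obtain ⟨rep, hidem, hfin, hrep⟩ := (hmono M hMT).exists_representatives
  let J := representatives rep
  let ι := sublangHom L J
  let ψ := collapseHom L rep
  have hJ : J.Countable := representatives_countable hfin
  let TJ := @completeTheory (sublang L J) M (ι.reduct M)
  have expand (S : (sublang L J).Structure ℕ) (hS : ℕ ⊨ TJ) :
      @Theory.Model L ℕ (ψ.reduct ℕ) T := model_collapseHom_reduct hMT hrep hS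
  have restrict (S : L.Structure ℕ) (hS : ℕ ⊨ T) :
      @Theory.Model (sublang L J) ℕ (ι.reduct ℕ) TJ :=
    model_completeTheory_sublangHom_reduct hcomplete J hMT hS
  have collapse_restrict (S : L.Structure ℕ) (hS : ℕ ⊨ T) :
      @LHom.reduct _ _ ψ ℕ (ι.reduct ℕ) = S := by
    refine collapseHom_reduct_sublangHom_reduct S fun n R => ?_
    rw [← realize_relIffSentence, hcomplete.realize_sentence_iff,
      ← hcomplete.realize_sentence_iff _ M, realize_relIffSentence]
    exact hrep n R
  have restrict_collapse (S : (sublang L J).Structure ℕ) :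
      @LHom.reduct _ _ ι ℕ (ψ.reduct ℕ) = S := sublangHom_reduct_collapseHom_reduct hidem S
  refine ⟨?_, J, hJ, TJ, @completeTheory.isComplete _ M (ι.reduct M) _, ?_, ?_⟩
  · obtain ⟨S, hS⟩ := @exists_countable_model_completeTheory (sublang L J) (card_sublang_le hJ) M
      (ι.reduct M) _
    exact ⟨ℕ, ψ.reduct ℕ, inferInstance, expand S hS⟩
  · intro N S hN
    let := ψ.reduct N
    have hN' := (hmono N (model_collapseHom_reduct hMT hrep hN)).sublangHom_reduct J
    rwa [sublangHom_reduct_collapseHom_reduct hidem S] at hN'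
  · let E : {S : (sublang L J).Structure ℕ // ℕ ⊨ TJ} ≃ {S : L.Structure ℕ // ℕ ⊨ T} :=
      { toFun := fun S => ⟨@LHom.reduct _ _ ψ ℕ S.1, expand S.1 S.2⟩
        invFun := fun S => ⟨@LHom.reduct _ _ ι ℕ S.1, restrict S.1 S.2⟩
        left_inv := fun S => Subtype.ext (restrict_collapse S.1)
        right_inv := fun S => Subtype.ext (collapse_restrict S.1 S.2) }
    refine (Cardinal.mk_uLift _).symm.trans (Cardinal.mk_congr (Equiv.ulift.trans
      (Quot.congr E fun S₁ S₂ => ⟨nonempty_equiv_reduct ψ S₁.1 S₂.1, fun h => ?_⟩)))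
    have h' := nonempty_equiv_reduct ι _ _ h
    rwa [restrict_collapse S₁.1, restrict_collapse S₂.1] at h'
end

section
/- Let L be a countable relational first-order language and let Y be a countably infinite L-structure chained by a linear order < on its domain such that the complete first-order theory of the linear order (Y,<) is ℵ₀-categorical. Then the complete first-order theory of Y is ℵ₀-categorical. -/
open FirstOrder Cardinal

universe u v w w' x

namespace FirstOrder.Language

/-- A formula valid in `M` is valid in every structure
elementarily equivalent to `M`. -/
theorem ElementarilyEquivalent.forall_realize {L : Language.{u, v}} {M : Type w} {N : Type w'}
    [L.Structure M] [L.Structure N] (h : M ≅[L] N) {α : Type x} [Finite α] {φ : L.Formula α}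
    (hφ : ∀ a : α → M, φ.Realize a) (b : α → N) : φ.Realize b := by
  have key := (h.realize_sentence (Formula.iAlls α (φ.relabel (Sum.inr : α → Empty ⊕ α)))).1
  simp only [Sentence.Realize, Formula.realize_iAlls, Formula.realize_relabel] at key
  exact key (fun a => hφ _) b

theorem elementarilyEquivalent_of_model_completeTheory (L : Language.{u, v}) (M : Type w)
    (N : Type w') [L.Structure M] [L.Structure N] [N ⊨ L.completeTheory M] : M ≅[L] N :=
  elementarilyEquivalent_iff.2 fun φ => (realize_iff_of_model_completeTheory M N φ).symm

/-- A structure is atomic if every finite tuple satisfies a formula that implies, in the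
structure, every formula satisfied by the tuple. -/
def IsAtomic (L : Language.{u, v}) (M : Type w) [L.Structure M] : Prop :=
  ∀ (n : ℕ) (a : Fin n → M), ∃ θ : L.Formula (Fin n), θ.Realize a ∧
    ∀ ψ : L.Formula (Fin n), ψ.Realize a → ∀ b : Fin n → M, θ.Realize b → ψ.Realize b

section BackAndForth

variable {L : Language.{u, v}} {M : Type w} {N : Type w'} [L.Structure M] [L.Structure N]

/-- A relation between two structures is partial elementary if tuples related to each other
satisfy the same formulas. -/
def IsPartialElementary (L : Language.{u, v}) {M : Type w} {N : Type w'} [L.Structure M]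
    [L.Structure N] (s : Set (M × N)) : Prop :=
  ∀ (n : ℕ) (g : Fin n → M × N), (∀ i, g i ∈ s) → ∀ φ : L.Formula (Fin n),
    φ.Realize (fun i => (g i).1) ↔ φ.Realize (fun i => (g i).2)

theorem IsPartialElementary.swap {s : Set (M × N)} (hs : IsPartialElementary L s) :
    IsPartialElementary L (Prod.swap ⁻¹' s) :=
  fun n g hg φ => (hs n (fun i => (g i).swap) hg φ).symm

theorem isPartialElementary_empty (h : M ≅[L] N) :
    IsPartialElementary L (∅ : Set (M × N)) := by
  intro n g hg φ
  obtain rfl : n = 0 := by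
    by_contra hn
    exact hg ⟨0, Nat.pos_of_ne_zero hn⟩
  constructor
  · intro hφ
    exact h.forall_realize (fun a => by rwa [Subsingleton.elim a]) _
  · intro hφ
    exact h.symm.forall_realize (fun a => by rwa [Subsingleton.elim a]) _

theorem IsPartialElementary.exists_insert_left (h : M ≅[L] N) (hM : IsAtomic L M)
    {s : Set (M × N)} (hs : IsPartialElementary L s) (hfin : s.Finite) (a : M) :
    ∃ b : N, IsPartialElementary L (insert (a, b) s) := by
  obtain ⟨k, g, hg⟩ : ∃ (k : ℕ) (g : Fin k → M × N), Set.range g = s := by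
    obtain ⟨k, e⟩ := @Finite.exists_equiv_fin s hfin
    refine ⟨k, fun i => (e.some.symm i : M × N), ?_⟩
    exact (e.some.symm.surjective.range_comp Subtype.val).trans Subtype.range_coe
  obtain ⟨θ, hθ, hθi⟩ := hM (k + 1) (Fin.snoc (fun i => (g i).1) a)
  obtain ⟨b, hb⟩ : ∃ b, θ.Realize (Fin.snoc (fun i => (g i).2) b : Fin (k + 1) → N) := by
    let η : L.Formula (Fin k) :=
      Formula.iExs Unit (θ.relabel (Fin.snoc Sum.inl (Sum.inr ()) : Fin (k + 1) → Fin k ⊕ Unit))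
    have hη : η.Realize (fun i => (g i).2) := by
      refine (hs k g (fun i => hg ▸ Set.mem_range_self i) η).1 ?_
      simp only [η, Formula.realize_iExs, Formula.realize_relabel, Fin.comp_snoc]
      exact ⟨fun _ => a, hθ⟩
    simp only [η, Formula.realize_iExs, Formula.realize_relabel, Fin.comp_snoc] at hη
    obtain ⟨i, hi⟩ := hη
    exact ⟨i (), hi⟩
  have himp : ∀ ψ : L.Formula (Fin (k + 1)),
      ψ.Realize (Fin.snoc (fun i => (g i).1) a : Fin (k + 1) → M) →
        ψ.Realize (Fin.snoc (fun i => (g i).2) b : Fin (k + 1) → N) := by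
    intro ψ hψ
    have := h.forall_realize (φ := θ.imp ψ)
      (fun c => by simpa using hθi ψ hψ c) (Fin.snoc (fun i => (g i).2) b)
    exact (Formula.realize_imp.1 this) hb
  have hiff : ∀ ψ : L.Formula (Fin (k + 1)),
      ψ.Realize (Fin.snoc (fun i => (g i).1) a : Fin (k + 1) → M) ↔
        ψ.Realize (Fin.snoc (fun i => (g i).2) b : Fin (k + 1) → N) := by
    refine fun ψ => ⟨himp ψ, fun hψ => by_contra fun hn => ?_⟩
    exact Formula.realize_not.1 (himp ψ.not (Formula.realize_not.2 hn)) hψ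
  refine ⟨b, fun n f hf φ => ?_⟩
  have hidx : ∀ i, ∃ j : Fin (k + 1), (Fin.snoc g (a, b) : Fin (k + 1) → M × N) j = f i := by
    intro i
    rcases hf i with hi | hi
    · exact ⟨Fin.last k, by simp [hi]⟩
    · rw [← hg] at hi
      obtain ⟨j, hj⟩ := hi
      exact ⟨j.castSucc, by simp [hj]⟩
  choose e he using hidx
  have h1 : (fun i => (f i).1) = (Fin.snoc (fun i => (g i).1) a : Fin (k + 1) → M) ∘ e := by
    funext i
    rw [← he i]
    exact congrFun (Fin.comp_snoc Prod.fst g (a, b)) (e i)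
  have h2 : (fun i => (f i).2) = (Fin.snoc (fun i => (g i).2) b : Fin (k + 1) → N) ∘ e := by
    funext i
    rw [← he i]
    exact congrFun (Fin.comp_snoc Prod.snd g (a, b)) (e i)
  rw [h1, h2, ← Formula.realize_relabel, ← Formula.realize_relabel]
  exact hiff _

theorem IsPartialElementary.exists_insert_right (h : M ≅[L] N) (hN : IsAtomic L N)
    {s : Set (M × N)} (hs : IsPartialElementary L s) (hfin : s.Finite) (b : N) :
    ∃ a : M, IsPartialElementary L (insert (a, b) s) := by
  obtain ⟨a, ha⟩ := hs.swap.exists_insert_left h.symm hN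
    (hfin.preimage Prod.swap_injective.injOn) b
  refine ⟨a, ?_⟩
  convert ha.swap using 1
  ext ⟨c, d⟩
  simp [and_comm]

theorem IsPartialElementary.fst_eq_iff {s : Set (M × N)} (hs : IsPartialElementary L s)
    {p q : M × N} (hp : p ∈ s) (hq : q ∈ s) : p.1 = q.1 ↔ p.2 = q.2 := by
  have := hs 2 ![p, q] (by simp [Fin.forall_fin_two, hp, hq])
    (Term.equal (Term.var 0) (Term.var 1))
  simpa using this

/-- A partial elementary relation which is total on both sides is an isomorphism. -/
theorem IsPartialElementary.nonempty_equiv [L.IsRelational] {s : Set (M × N)}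
    (hs : IsPartialElementary L s) (hl : ∀ a, ∃ b, (a, b) ∈ s) (hr : ∀ b, ∃ a, (a, b) ∈ s) :
    Nonempty (M ≃[L] N) := by
  choose f hf using hl
  choose g hg using hr
  refine ⟨⟨⟨f, g, fun a => ?_, fun b => ?_⟩, fun F => isEmptyElim F, fun {n} R a => ?_⟩⟩
  · exact (hs.fst_eq_iff (hg (f a)) (hf a)).2 rfl
  · exact (hs.fst_eq_iff (hf (g b)) (hg b)).1 rfl
  · have := hs n (fun i => (a i, f (a i))) (fun i => hf (a i)) (R.formula Term.var)
    simpa [Formula.realize_rel, Function.comp_def] using this.symm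

/-- Elementarily equivalent countable atomic structures are isomorphic. -/
theorem IsAtomic.nonempty_equiv [L.IsRelational] [Countable M] [Countable N] (h : M ≅[L] N)
    (hM : IsAtomic L M) (hN : IsAtomic L N) : Nonempty (M ≃[L] N) := by
  classical
  let P := {s : Finset (M × N) // IsPartialElementary L (s : Set (M × N))}
  let D : M ⊕ N → Order.Cofinal P := Sum.elim
    (fun a =>
      { carrier := {s | ∃ b, (a, b) ∈ s.1}
        isCofinal := fun s => by
          obtain ⟨b, hb⟩ := s.2.exists_insert_left h hM s.1.finite_toSet a
          exact ⟨⟨insert (a, b) s.1, by simpa using hb⟩, ⟨b, by simp⟩, Finset.subset_insert _ _⟩ })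
    (fun b =>
      { carrier := {s | ∃ a, (a, b) ∈ s.1}
        isCofinal := fun s => by
          obtain ⟨a, ha⟩ := s.2.exists_insert_right h hN s.1.finite_toSet b
          exact ⟨⟨insert (a, b) s.1, by simpa using ha⟩, ⟨a, by simp⟩, Finset.subset_insert _ _⟩ })
  let _ := Encodable.ofCountable (M ⊕ N)
  let J := Order.idealOfCofinals (⟨∅, by simpa using isPartialElementary_empty h⟩ : P) D
  have hJ := Order.cofinal_meets_idealOfCofinals
    (⟨∅, by simpa using isPartialElementary_empty h⟩ : P) D
  refine IsPartialElementary.nonempty_equiv (L := L) (s := {p | ∃ s ∈ J, p ∈ s.1}) ?_ ?_ ?_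
  · intro n g hg φ
    choose s hsJ hs using hg
    have := J.nonempty.to_subtype
    obtain ⟨t, ht⟩ := (directedOn_iff_directed.1 J.directed).finite_le (fun i => ⟨s i, hsJ i⟩)
    exact t.1.2 n g (fun i => ht i (hs i)) φ
  · intro a
    obtain ⟨s, ⟨b, hb⟩, hs⟩ := hJ (Sum.inl a)
    exact ⟨b, s, hs, hb⟩
  · intro b
    obtain ⟨s, ⟨a, ha⟩, hs⟩ := hJ (Sum.inr b)
    exact ⟨a, s, hs, ha⟩

end BackAndForth

section Definable

variable {L : Language.{u, v}} {M : Type w} {N : Type w'} [L.Structure M] [L.Structure N]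

/-- If the relations of an `L`-structure are definable in an `L'`-structure on the same domain,
then so are all `L`-formulas. -/
theorem BoundedFormula.exists_translation [L.IsRelational] {L' : Language.{w', x}}
    [L'.Structure M]
    (hdef : ∀ (m : ℕ) (R : L.Relations m), ∃ φ : L'.Formula (Fin m), ∀ a : Fin m → M,
      Structure.RelMap R a ↔ φ.Realize a)
    {α : Type*} {n : ℕ} (φ : L.BoundedFormula α n) :
    ∃ ψ : L'.BoundedFormula α n, ∀ (a : α → M) (b : Fin n → M),
      φ.Realize a b ↔ ψ.Realize a b := by
  have hvar : ∀ {n : ℕ} (t : L.Term (α ⊕ Fin n)), ∃ i, t = Term.var i := by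
    rintro n (i | ⟨f, _⟩)
    · exact ⟨i, rfl⟩
    · exact isEmptyElim f
  induction φ with
  | falsum => exact ⟨⊥, fun _ _ => Iff.rfl⟩
  | equal s t =>
    obtain ⟨i, rfl⟩ := hvar s
    obtain ⟨j, rfl⟩ := hvar t
    exact ⟨(Term.var i).bdEqual (Term.var j), fun _ _ => Iff.rfl⟩
  | @rel n l R ts =>
    obtain ⟨φ, hφ⟩ := hdef l R
    choose g hg using fun i => hvar (ts i)
    refine ⟨BoundedFormula.relabel (k := 0) g φ, fun a b => ?_⟩
    change Structure.RelMap R (fun i => (ts i).realize (Sum.elim a b)) ↔ _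
    rw [hφ, BoundedFormula.realize_relabel, Formula.Realize]
    simp [hg, Function.comp_def, Unique.eq_default]
  | imp _ _ ih₁ ih₂ =>
    obtain ⟨ψ₁, h₁⟩ := ih₁
    obtain ⟨ψ₂, h₂⟩ := ih₂
    exact ⟨ψ₁.imp ψ₂, fun a b => imp_congr (h₁ a b) (h₂ a b)⟩
  | all _ ih =>
    obtain ⟨ψ, h⟩ := ih
    exact ⟨ψ.all, fun a b => forall_congr' fun c => h a _⟩

/-- If the `n`-tuples of `M` have only finitely many types for every `n`, then every structure
elementarily equivalent to `M` is atomic. -/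
theorem ElementarilyEquivalent.isAtomic_of_finite (h : M ≅[L] N)
    (hfin : ∀ n : ℕ, ∃ (ι : Type) (_ : Finite ι) (f : (Fin n → M) → ι), ∀ a b, f a = f b →
      ∀ φ : L.Formula (Fin n), φ.Realize a → φ.Realize b) : IsAtomic L N := by
  intro n x
  obtain ⟨ι, _, f, hf⟩ := hfin n
  have hiso : ∀ t : ι, ∃ θ : L.Formula (Fin n), (∀ a, f a = t → θ.Realize a) ∧
      ∀ ψ : L.Formula (Fin n), (∀ b : Fin n → M, θ.Realize b → ψ.Realize b) ∨
        ∀ b : Fin n → M, θ.Realize b → ¬ψ.Realize b := by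
    intro t
    by_cases ht : ∃ a, f a = t
    swap
    · exact ⟨⊥, fun a ha => (ht ⟨a, ha⟩).elim, fun ψ => Or.inl fun b hb => hb.elim⟩
    obtain ⟨a, rfl⟩ := ht
    have hsep : ∀ t : ι, ∃ ψ : L.Formula (Fin n), ψ.Realize a ∧
        ∀ b, f b = t → ψ.Realize b → ∀ χ : L.Formula (Fin n), χ.Realize a → χ.Realize b := by
      intro t
      by_cases hd : ∃ d, f d = t ∧ ∃ χ : L.Formula (Fin n), χ.Realize a ∧ ¬χ.Realize d
      · obtain ⟨d, rfl, χ, hχa, hχd⟩ := hd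
        exact ⟨χ, hχa, fun b hb hχb => (hχd (hf b d hb χ hχb)).elim⟩
      · push Not at hd
        exact ⟨⊤, Formula.realize_top.2 trivial, fun b hb _ χ => hd b hb χ⟩
    choose ψ hψa hψ using hsep
    refine ⟨Formula.iInf ψ, fun b hb => hf a b hb.symm _ (Formula.realize_iInf.2 hψa), ?_⟩
    intro χ
    by_cases hχ : χ.Realize a
    · exact Or.inl fun b hb => hψ (f b) b rfl (Formula.realize_iInf.1 hb _) χ hχ
    · exact Or.inr fun b hb => Formula.realize_not.1 <|
        hψ (f b) b rfl (Formula.realize_iInf.1 hb _) χ.not (Formula.realize_not.2 hχ)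
  choose θ hθ hdec using hiso
  obtain ⟨t, ht⟩ := Formula.realize_iSup.1 <| h.forall_realize (φ := Formula.iSup θ)
    (fun a => Formula.realize_iSup.2 ⟨f a, hθ _ a rfl⟩) x
  refine ⟨θ t, ht, fun ψ hψ y hy => ?_⟩
  rcases hdec t ψ with hd | hd
  · exact Formula.realize_imp.1 (h.forall_realize (φ := (θ t).imp ψ)
      (fun b => Formula.realize_imp.2 (hd b)) y) hy
  · exact (Formula.realize_not.1 (Formula.realize_imp.1
      (h.forall_realize (φ := (θ t).imp ψ.not)
        (fun b => Formula.realize_imp.2 fun hb => Formula.realize_not.2 (hd b hb)) x) ht) hψ).elim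

end Definable

section OmittingTypes

open Theory CompleteType

variable {L : Language.{u, v}} {T : L.Theory}

theorem Formula.realize_congr_of_eqOn_freeVarFinset {M : Type w} [L.Structure M] {α : Type x}
    [DecidableEq α] {φ : L.Formula α} {a b : α → M} (h : ∀ i ∈ φ.freeVarFinset, a i = b i) :
    φ.Realize a ↔ φ.Realize b := by
  have ha := BoundedFormula.realize_restrictFreeVar (φ := φ) (f := id)
    (v := fun i => a i) (xs := default) a (fun _ => rfl)
  have hb := BoundedFormula.realize_restrictFreeVar (φ := φ) (f := id)
    (v := fun i => a i) (xs := default) b (fun i => h i i.2)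
  exact ha.symm.trans hb

theorem Theory.typeOf_eq_typeOf_iff {M : Type w} {N : Type w'} [L.Structure M] [L.Structure N]
    [Nonempty M] [Nonempty N] [M ⊨ T] [N ⊨ T] {α : Type x} {a : α → M} {b : α → N} :
    T.typeOf a = T.typeOf b ↔ ∀ φ : L.Formula α, φ.Realize a ↔ φ.Realize b := by
  rw [SetLike.ext_iff, ← Formula.equivSentence.forall_congr_right]
  simp only [formula_mem_typeOf]

/-- Density in the space of types, in terms of realizations. -/
theorem Theory.CompleteType.dense_of_forall_realize {α : Type x} {S : Set (T.CompleteType α)}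
    (h : ∀ (χ : L.Formula α) (N : Theory.ModelType.{u, v, max u v x} T) (a : α → N),
      χ.Realize a → ∃ p ∈ S, Formula.equivSentence χ ∈ p) : Dense S := by
  refine isTopologicalBasis_range_typesWith.dense_iff.2 ?_
  rintro _ ⟨χ, rfl⟩ ⟨p, hp⟩
  obtain ⟨N, a, rfl⟩ := T.exists_modelType_is_realized_in p
  obtain ⟨r, hrS, hr⟩ := h (Formula.equivSentence.symm χ) N a (mem_typeOf.1 hp)
  exact ⟨r, by simpa using hr, hrS⟩

/-- The types `p` in countably many variables such that `∃ y, φ(y)` belongs to `p` only if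
`φ` holds, according to `p`, of one of the variables. -/
def Theory.henkinTypes (T : L.Theory) (φ : L.Formula (ℕ ⊕ Unit)) : Set (T.CompleteType ℕ) :=
  (T.typesWith (Formula.equivSentence (φ.iExs Unit)))ᶜ ∪
    ⋃ m : ℕ, T.typesWith (Formula.equivSentence (φ.relabel (Sum.elim id fun _ => m)))

theorem Theory.isOpen_henkinTypes (φ : L.Formula (ℕ ⊕ Unit)) : IsOpen (T.henkinTypes φ) :=
  (isClosed_typesWith _).isOpen_compl.union (isOpen_iUnion fun _ => isOpen_typesWith _)

theorem Theory.typeOf_mem_henkinTypes {M : Type w} [L.Structure M] [Nonempty M] [M ⊨ T]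
    {φ : L.Formula (ℕ ⊕ Unit)} {a : ℕ → M} :
    T.typeOf a ∈ T.henkinTypes φ ↔
      ((∃ c, φ.Realize (Sum.elim a fun _ => c)) → ∃ m, φ.Realize (Sum.elim a fun _ => a m)) := by
  have hcomp : ∀ m, a ∘ Sum.elim id (fun _ : Unit => m) = Sum.elim a fun _ => a m := by
    intro m
    rw [Sum.comp_elim]
    rfl
  have hex : (∃ i : Unit → M, φ.Realize (Sum.elim a i)) ↔
      ∃ c, φ.Realize (Sum.elim a fun _ => c) :=
    ⟨fun ⟨i, hi⟩ => ⟨i (), hi⟩, fun ⟨c, hc⟩ => ⟨_, hc⟩⟩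
  simp only [henkinTypes, Set.mem_union, Set.mem_compl_iff, Set.mem_iUnion, mem_typesWith_iff,
    formula_mem_typeOf, Formula.realize_iExs, Formula.realize_relabel, hcomp, hex,
    imp_iff_not_or]

theorem Theory.dense_henkinTypes (φ : L.Formula (ℕ ⊕ Unit)) : Dense (T.henkinTypes φ) := by
  refine dense_of_forall_realize fun χ N a hχ => ?_
  by_cases hc : ∃ c, φ.Realize (Sum.elim a fun _ => c)
  swap
  · exact ⟨T.typeOf a, typeOf_mem_henkinTypes.2 fun h => (hc h).elim, formula_mem_typeOf.2 hχ⟩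
  obtain ⟨c, hc⟩ := hc
  obtain ⟨m, hm⟩ := Infinite.exists_notMem_finset (χ.freeVarFinset ∪ φ.freeVarFinset.toLeft)
  simp only [Finset.mem_union, Finset.mem_toLeft, not_or] at hm
  refine ⟨T.typeOf (Function.update a m c), typeOf_mem_henkinTypes.2 fun _ => ⟨m, ?_⟩,
    formula_mem_typeOf.2 ?_⟩
  rotate_left
  · refine (Formula.realize_congr_of_eqOn_freeVarFinset fun i hi => ?_).1 hχ
    rw [Function.update_of_ne (by rintro rfl; exact hm.1 hi)]
  · refine (Formula.realize_congr_of_eqOn_freeVarFinset ?_).1 hc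
    rintro (i | i) hi
    · simp only [Sum.elim_inl]
      rw [Function.update_of_ne (by rintro rfl; exact hm.2 hi)]
    · simp

/-- The types `p` in countably many variables for which the variables `g 0, …, g (n - 1)` do not
realize `q`. -/
def Theory.CompleteType.omittingTypes {n : ℕ} (q : T.CompleteType (Fin n)) (g : Fin n → ℕ) :
    Set (T.CompleteType ℕ) :=
  ⋃ ψ ∈ {ψ : L.Formula (Fin n) | Formula.equivSentence ψ ∈ q},
    (T.typesWith (Formula.equivSentence (ψ.relabel g)))ᶜ

theorem Theory.CompleteType.isOpen_omittingTypes {n : ℕ} (q : T.CompleteType (Fin n))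
    (g : Fin n → ℕ) : IsOpen (q.omittingTypes g) :=
  isOpen_biUnion fun _ _ => (isClosed_typesWith _).isOpen_compl

theorem Theory.CompleteType.typeOf_mem_omittingTypes {M : Type w} [L.Structure M] [Nonempty M]
    [M ⊨ T] {n : ℕ} {q : T.CompleteType (Fin n)} {g : Fin n → ℕ} {a : ℕ → M} :
    T.typeOf a ∈ q.omittingTypes g ↔ T.typeOf (a ∘ g) ≠ q := by
  have hmem : T.typeOf a ∈ q.omittingTypes g ↔
      ∃ ψ : L.Formula (Fin n), Formula.equivSentence ψ ∈ q ∧ ¬ψ.Realize (a ∘ g) := by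
    simp only [omittingTypes, Set.mem_iUnion, Set.mem_ofPred_eq, Set.mem_compl_iff,
      mem_typesWith_iff, formula_mem_typeOf, Formula.realize_relabel, exists_prop]
  rw [hmem]
  constructor
  · rintro ⟨ψ, hψ, hn⟩ rfl
    exact hn (formula_mem_typeOf.1 hψ)
  · intro hne
    by_contra! hall
    obtain ⟨N, b, rfl⟩ := T.exists_modelType_is_realized_in q
    simp only [formula_mem_typeOf] at hall
    refine hne (typeOf_eq_typeOf_iff.2 fun φ => ⟨fun h => ?_, hall φ⟩)
    by_contra hb
    exact Formula.realize_not.1 (hall φ.not (Formula.realize_not.2 hb)) h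

theorem Theory.CompleteType.dense_omittingTypes {n : ℕ} {q : T.CompleteType (Fin n)}
    (hq : ¬IsOpen {q}) (g : Fin n → ℕ) : Dense (q.omittingTypes g) := by
  refine dense_of_forall_realize fun χ N a hχ => ?_
  by_contra! hall
  let F := χ.freeVarFinset ∪ Finset.univ.image g
  have hF : ∀ i, g i ∈ F := fun i => Finset.mem_union_right _ (by simp)
  let χF : L.Formula F := χ.restrictFreeVar fun i => ⟨i, Finset.mem_union_left _ i.2⟩
  let η : L.Formula (Fin n) := Formula.iExs F (χF.relabel Sum.inr ⊓
    Formula.iInf fun i => Term.equal (Term.var (Sum.inl i)) (Term.var (Sum.inr ⟨g i, hF i⟩)))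
  have hη : ∀ (N : Theory.ModelType.{u, v, max u v} T) (c : Fin n → N),
      η.Realize c ↔ ∃ b : ℕ → N, χ.Realize b ∧ b ∘ g = c := by
    intro N c
    have hχF : ∀ b : ℕ → N, χF.Realize (fun i => b i) ↔ χ.Realize b := fun b =>
      BoundedFormula.realize_restrictFreeVar (φ := χ) b (fun _ => rfl)
    have hηF : η.Realize c ↔ ∃ d : F → N, χF.Realize d ∧ ∀ i, c i = d ⟨g i, hF i⟩ := by
      simp only [η, Formula.realize_iExs, Formula.realize_inf, Formula.realize_relabel,
        Formula.realize_iInf, Formula.realize_equal, Term.realize_var, Sum.elim_comp_inr,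
        Sum.elim_inl, Sum.elim_inr]
    rw [hηF]
    constructor
    · rintro ⟨d, hd, hc⟩
      have hext : (fun i : F => Function.extend Subtype.val d
          (fun _ => Classical.arbitrary N) i) = d :=
        funext fun i => Subtype.val_injective.extend_apply _ _ i
      refine ⟨Function.extend Subtype.val d (fun _ => Classical.arbitrary N), ?_, ?_⟩
      · rwa [← hχF, hext]
      · funext i
        rw [hc]
        exact congrFun hext ⟨g i, hF i⟩
    · rintro ⟨b, hb, rfl⟩
      exact ⟨fun i => b i, (hχF b).2 hb, fun _ => rfl⟩
  have hreal : ∀ (N : Theory.ModelType.{u, v, max u v} T) (b : ℕ → N), χ.Realize b →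
      T.typeOf (b ∘ g) = q := by
    intro N b hb
    by_contra hne
    exact hall _ (typeOf_mem_omittingTypes.2 hne) (formula_mem_typeOf.2 hb)
  refine hq ?_
  convert isOpen_typesWith (T := T) (Formula.equivSentence η)
  ext r
  constructor
  · rintro rfl
    rw [← hreal N a hχ]
    exact formula_mem_typeOf.2 ((hη N _).2 ⟨a, hχ, rfl⟩)
  · intro hr
    obtain ⟨N', c, rfl⟩ := T.exists_modelType_is_realized_in r
    obtain ⟨b, hb, rfl⟩ := (hη N' c).1 (formula_mem_typeOf.1 hr)
    exact hreal N' b hb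

/-- The **omitting types theorem** for one non-isolated type in a countable relational language. -/
theorem Theory.CompleteType.exists_countable_model_omitting [L.IsRelational] [Countable L.Symbols]
    {n : ℕ} {q : T.CompleteType (Fin n)} (hq : ¬IsOpen {q}) :
    ∃ N : Theory.ModelType.{u, v, max u v} T, Countable N ∧
      ∀ c : Fin n → N, T.typeOf c ≠ q := by
  have : Nonempty (T.CompleteType ℕ) := by
    obtain ⟨N, -⟩ := T.exists_modelType_is_realized_in q
    exact ⟨T.typeOf fun _ : ℕ => Classical.arbitrary N⟩
  have hdense : Dense ((⋂ φ, T.henkinTypes φ) ∩ ⋂ g, q.omittingTypes g) :=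
    (dense_iInter_of_isOpen isOpen_henkinTypes dense_henkinTypes).inter_of_Gδ
      (IsGδ.iInter_of_isOpen isOpen_henkinTypes)
      (IsGδ.iInter_of_isOpen q.isOpen_omittingTypes)
      (dense_iInter_of_isOpen q.isOpen_omittingTypes (dense_omittingTypes hq))
  obtain ⟨p, hpH, hpO⟩ := hdense.nonempty
  rw [Set.mem_iInter] at hpH hpO
  obtain ⟨N, a, rfl⟩ := T.exists_modelType_is_realized_in p
  simp only [typeOf_mem_henkinTypes] at hpH
  simp only [typeOf_mem_omittingTypes] at hpO
  let S₀ : L.Substructure N := ⟨Set.range a, fun f => isEmptyElim f⟩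
  let S : L.ElementarySubstructure N := S₀.toElementarySubstructure <| by
    intro k φ y c hc
    choose g hg using fun i => (y i).2
    let ψ : L.Formula (ℕ ⊕ Unit) := φ.toFormula.relabel <|
      Sum.elim Empty.elim (Fin.snoc (fun i => Sum.inl (g i)) (Sum.inr ()) : Fin (k + 1) → _)
    have hψ : ∀ d : N, ψ.Realize (Sum.elim a fun _ => d) ↔
        φ.Realize default (Fin.snoc ((↑) ∘ y) d : Fin (k + 1) → N) := by
      intro d
      simp only [ψ, Formula.realize_relabel, BoundedFormula.realize_toFormula]
      have hd : (Sum.elim a (fun _ => d) ∘ Sum.elim Empty.elim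
          (Fin.snoc (fun i => Sum.inl (g i)) (Sum.inr ()) : Fin (k + 1) → ℕ ⊕ Unit)) ∘ Sum.inr =
            (Fin.snoc ((↑) ∘ y) d : Fin (k + 1) → N) := by
        rw [Function.comp_assoc, Sum.elim_comp_inr, Fin.comp_snoc]
        congr 1
        exact funext hg
      rw [hd, Unique.eq_default (_ ∘ Sum.inl)]
    obtain ⟨m, hm⟩ := hpH ψ ⟨c, (hψ c).2 hc⟩
    exact ⟨⟨a m, m, rfl⟩, (hψ _).1 hm⟩
  refine ⟨S.toModel T, (Set.countable_range a).to_subtype, fun c hc => ?_⟩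
  choose g hg using fun i => (c i).2
  refine hpO g (Eq.trans ?_ hc)
  have hcg : a ∘ g = S.subtype ∘ c := funext hg
  rw [hcg]
  exact typeOf_eq_typeOf_iff.2 fun φ => S.subtype.map_formula φ c

/-- The types of an `ℵ₀`-categorical theory without finite models are isolated. -/
theorem Theory.CompleteType.isOpen_singleton_of_categorical {L : Language.{0, 0}}
    [L.IsRelational] [Countable L.Symbols] {T : L.Theory}
    (hinf : ∀ N : Theory.ModelType.{0, 0, 0} T, Infinite N)
    (hcat : Cardinal.Categorical (Cardinal.aleph0.{w}) T) {n : ℕ} (q : T.CompleteType (Fin n)) :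
    IsOpen {q} := by
  by_contra hq
  obtain ⟨N₁, hN₁, homit⟩ := exists_countable_model_omitting hq
  obtain ⟨N, c, hc⟩ := T.exists_modelType_is_realized_in q
  have := hinf N
  have := hinf N₁
  obtain ⟨S, hcS, hS⟩ := exists_elementarySubstructure_card_eq (L := L) (Set.range c)
    Cardinal.aleph0.{0} le_rfl (by simp)
    (by rw [Cardinal.lift_id, Cardinal.lift_id]; exact Cardinal.mk_le_aleph0 (α := L.Symbols))
    (by simp)
  let N₂ : T.ModelType := S.toModel T
  have hN₂ : Cardinal.mk N₂ = Cardinal.aleph0 := by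
    rw [Cardinal.lift_id, Cardinal.lift_id] at hS
    exact hS
  let c₂ : Fin n → S := fun i => ⟨c i, hcS ⟨i, rfl⟩⟩
  have hc₂ : T.typeOf (M := N₂) c₂ = q :=
    (typeOf_eq_typeOf_iff.2 fun φ => (S.subtype.map_formula φ c₂).symm).trans hc
  obtain ⟨e⟩ := hcat (Theory.ModelType.ulift.{0, 0, 0, w} N₂)
    (Theory.ModelType.ulift.{0, 0, 0, w} N₁)
    ((Cardinal.mk_uLift _).trans (by rw [hN₂, Cardinal.lift_aleph0]))
    ((Cardinal.mk_uLift _).trans (by rw [Cardinal.mk_eq_aleph0, Cardinal.lift_aleph0]))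
  let e₂ : N₂ ≃[L] Theory.ModelType.ulift.{0, 0, 0, w} N₂ :=
    (Equiv.ulift.{w, 0}.symm : N₂ ≃ _).inducedStructureEquiv
  let e₁ : N₁ ≃[L] Theory.ModelType.ulift.{0, 0, 0, w} N₁ :=
    (Equiv.ulift.{w, 0}.symm : N₁ ≃ _).inducedStructureEquiv
  let f : N₂ ≃[L] N₁ := e₁.symm.comp (e.comp e₂)
  refine homit (f ∘ c₂) (Eq.trans ?_ hc₂)
  exact typeOf_eq_typeOf_iff.2 fun φ => StrongHomClass.realize_formula f φ

end OmittingTypes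

end FirstOrder.Language

open FirstOrder.Language in
/-- If a countably infinite structure `M` in a countable relational language is chained by
a linear order whose complete theory is `ℵ₀`-categorical, then the complete theory of `M`
is `ℵ₀`-categorical. -/
theorem aleph0_categorical_of_chained_by_aleph0_categorical_order
    (L : FirstOrder.Language.{u, v}) [L.IsRelational]
    (hcount : Countable (Σ n, L.Relations n))
    (M : Type w) [L.Structure M] [Countable M] [Infinite M]
    (lo : LinearOrder M) (hchain : Chains L lo)
    (hcat : Cardinal.Categorical Cardinal.aleph0
      (@FirstOrder.Language.completeTheory FirstOrder.Language.order M (ltStructure lo))) :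
    Cardinal.Categorical Cardinal.aleph0 (L.completeTheory M) := by
  let _ : Language.order.Structure M := ltStructure lo
  have hinf : ∀ N : Theory.ModelType.{0, 0, 0} (Language.order.completeTheory M), Infinite N :=
    fun N => (elementarilyEquivalent_of_model_completeTheory Language.order M N).infinite
  have hequiv : ∀ N : (L.completeTheory M).ModelType, M ≅[L] N :=
    fun N => elementarilyEquivalent_of_model_completeTheory L M N
  have hatomic : ∀ N : (L.completeTheory M).ModelType, IsAtomic L N := by
    refine fun N => (hequiv N).isAtomic_of_finite fun n => ?_
    have : DiscreteTopology ((Language.order.completeTheory M).CompleteType (Fin n)) :=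
      discreteTopology_iff_isOpen_singleton.2
        (Theory.CompleteType.isOpen_singleton_of_categorical hinf hcat)
    refine ⟨_, finite_of_compact_of_discrete, (Language.order.completeTheory M).typeOf, ?_⟩
    intro a b hab φ
    obtain ⟨ψ, hψ⟩ := BoundedFormula.exists_translation (L' := Language.order)
      (fun m R => (hchain m R).imp fun _ h => h.2) φ
    have := Theory.typeOf_eq_typeOf_iff.1 hab ψ
    exact fun ha => (hψ b _).2 (this.1 ((hψ a _).1 ha))
  intro N₁ N₂ h₁ h₂
  have : Countable N₁ := Cardinal.mk_le_aleph0_iff.1 h₁.le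
  have : Countable N₂ := Cardinal.mk_le_aleph0_iff.1 h₂.le
  exact (hatomic N₁).nonempty_equiv ((hequiv N₁).symm.trans (hequiv N₂)) (hatomic N₂)
end
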